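/- Assume F is tame with Disc F ⊆ {0}, and that dG(0) : ℝ^N → ℝ^K is not surjective. Then the composition H = G ∘ F is tame if and only if, as set germs at the origin of ℝ^N, closure(F(M(H) \ Sing H)) ∩ Sing G ⊆ {0}; precisely, if and only if there exist ε, δ > 0 with B̄_ε ⊆ U such that closure(F((M(H) \ Sing H) ∩ B̄_ε)) ∩ Sing G ∩ B_δ ⊆ {0}. -/

import Mathlib

open Metric Set Function Topology

noncomputable section

/-- The singular set of a map: points where the total derivative is not surjective. -/
def Sing {E F : Type*} [NormedAddCommGroup E] [NormedSpace ℝ E] [NormedAddCommGroup F]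
    [NormedSpace ℝ F] (P : E → F) : Set E :=
  {x | ¬ Function.Surjective ⇑(fderiv ℝ P x)}

/-- The Milnor set of a map (with respect to the Euclidean distance `‖x‖²`):
points where the derivative of `x ↦ (P x, ‖x‖²)` is not surjective. -/
def MilnorSet {E F : Type*} [NormedAddCommGroup E] [NormedSpace ℝ E] [NormedAddCommGroup F]
    [NormedSpace ℝ F] (P : E → F) : Set E :=
  {x | ¬ Function.Surjective ⇑(fderiv ℝ (fun y => (P y, ‖y‖ ^ 2)) x)}

/-- Tameness: as set germs at the origin, `closure(M(P) \ Sing P) ∩ Sing P ⊆ {0}`. -/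
def Tame {E F : Type*} [NormedAddCommGroup E] [NormedSpace ℝ E] [NormedAddCommGroup F]
    [NormedSpace ℝ F] (P : E → F) : Prop :=
  ∃ ε > 0, closure ((MilnorSet P \ Sing P) ∩ ball (0 : E) ε) ∩ Sing P ∩ ball (0 : E) ε ⊆ {0}



open scoped BoundedContinuousFunction

abbrev DiscT : Type := ↥(ball (0:ℂ) 1)

open scoped Classical in
def discExt (q : DiscT →ᵇ ℂ) : ℂ → ℂ := fun z => if h : z ∈ ball (0:ℂ) 1 then q ⟨z, h⟩ else 0

lemma discExt_of_mem (q : DiscT →ᵇ ℂ) {z : ℂ} (h : z ∈ ball (0:ℂ) 1) : discExt q z = q ⟨z, h⟩ := by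
  simp only [discExt]; rw [dif_pos h]

def HInfS : Subalgebra ℝ (DiscT →ᵇ ℂ) where
  carrier := {q | DifferentiableOn ℂ (discExt q) (ball 0 1)}
  mul_mem' := by
    intro p q hp hq
    refine (DifferentiableOn.mul hp hq).congr ?_
    intro z hz
    simp [discExt_of_mem _ hz]
  add_mem' := by
    intro p q hp hq
    refine (DifferentiableOn.add hp hq).congr ?_
    intro z hz
    simp [discExt_of_mem _ hz]
  algebraMap_mem' := by
    intro r
    refine (differentiableOn_const (c := (r:ℂ))).congr ?_
    intro z hz
    rw [discExt_of_mem _ hz]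
    rfl

lemma HInf_closed : IsClosed (HInfS : Set (DiscT →ᵇ ℂ)) := by
  rw [← isSeqClosed_iff_isClosed]
  intro u q hu hq
  have h1 : TendstoLocallyUniformlyOn (fun n => discExt (u n)) (discExt q) Filter.atTop (ball 0 1) := by
    apply TendstoUniformlyOn.tendstoLocallyUniformlyOn
    rw [Metric.tendstoUniformlyOn_iff]
    intro ε hε
    have := (Metric.tendsto_nhds.1 hq) ε hε
    filter_upwards [this] with n hn z hz
    rw [discExt_of_mem _ hz, discExt_of_mem _ hz]
    rw [dist_comm] at hn
    exact lt_of_le_of_lt (BoundedContinuousFunction.dist_coe_le_dist _) hn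
  exact h1.differentiableOn (Filter.Eventually.of_forall hu) isOpen_ball

def HInf : Type := ↥HInfS
instance : NormedCommRing HInf := inferInstanceAs (NormedCommRing ↥HInfS)
instance : NormedAlgebra ℝ HInf := inferInstanceAs (NormedAlgebra ℝ ↥HInfS)
instance : CompleteSpace HInf := HInf_closed.completeSpace_coe

lemma HInf_norm_le (q : HInf) {z : ℂ} (hz : z ∈ ball (0:ℂ) 1) : ‖discExt q.1 z‖ ≤ ‖q‖ := by
  rw [discExt_of_mem _ hz]
  exact BoundedContinuousFunction.norm_coe_le_norm q.1 _

lemma HInf_dslope_le (q : HInf) {z : ℂ} (hz : z ∈ ball (0:ℂ) 1) :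
    ‖dslope (discExt q.1) 0 z‖ ≤ 2 * ‖q‖ := by
  have h0 : (0:ℂ) ∈ ball (0:ℂ) 1 := by simp
  have := Complex.norm_dslope_le_div_of_mapsTo_ball (f := discExt q.1) (c := 0) (R₁ := 1)
    (R₂ := 2 * ‖q‖) (z := z) q.2 ?_ hz
  · rwa [div_one] at this
  · intro w hw
    rw [mem_closedBall, dist_eq_norm]
    calc _ ≤ ‖discExt q.1 w‖ + ‖discExt q.1 0‖ := norm_sub_le _ _
      _ ≤ _ := by linarith [HInf_norm_le q hw, HInf_norm_le q h0]

def HInf_mk (f : ℂ → ℂ) (hf : DifferentiableOn ℂ f (ball 0 1)) (C : ℝ)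
    (hC : ∀ z ∈ ball (0:ℂ) 1, ‖f z‖ ≤ C) : HInf :=
  ⟨BoundedContinuousFunction.ofNormedAddCommGroup (fun z : DiscT => f z)
    (by exact continuousOn_iff_continuous_domRestrict.1 hf.continuousOn) C (fun z => hC z.1 z.2), by
    refine hf.congr ?_
    intro z hz
    rw [discExt_of_mem _ hz]
    rfl⟩

lemma HInf_mk_apply (f : ℂ → ℂ) (hf) (C : ℝ) (hC) {z : ℂ} (hz : z ∈ ball (0:ℂ) 1) :
    discExt (HInf_mk f hf C hC).1 z = f z := by
  rw [discExt_of_mem _ hz]; rfl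

lemma HInf_ext {p q : HInf} (h : ∀ z ∈ ball (0:ℂ) 1, discExt p.1 z = discExt q.1 z) : p = q := by
  apply Subtype.ext
  ext z
  have := h z.1 z.2
  rw [discExt_of_mem _ z.2, discExt_of_mem _ z.2] at this
  exact this

lemma dslope_ball_diff (q : HInf) : DifferentiableOn ℂ (dslope (discExt q.1) 0) (ball 0 1) :=
  (Complex.differentiableOn_dslope (ball_mem_nhds _ one_pos)).2 q.2

lemma HInf_mk_norm_le (f : ℂ → ℂ) (hf) (C : ℝ) (hC0 : 0 ≤ C) (hC) : ‖HInf_mk f hf C hC‖ ≤ C := by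
  change ‖(HInf_mk f hf C hC).1‖ ≤ C
  rw [BoundedContinuousFunction.norm_le hC0]
  intro z
  exact hC z.1 z.2

lemma discExt_add (p q : DiscT →ᵇ ℂ) : discExt (p + q) = discExt p + discExt q := by
  ext z
  by_cases h : z ∈ ball (0:ℂ) 1
  · simp [discExt_of_mem _ h]
  · simp only [discExt, dif_neg h, Pi.add_apply, add_zero]

lemma discExt_smul (c : ℝ) (q : DiscT →ᵇ ℂ) : discExt (c • q) = (c : ℂ) • discExt q := by
  ext z
  by_cases h : z ∈ ball (0:ℂ) 1
  · simp [discExt_of_mem _ h]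
  · simp only [discExt, dif_neg h, Pi.smul_apply, smul_zero]

lemma dslope_eq (q : HInf) {z : ℂ} (hz : z ≠ 0) :
    dslope (discExt q.1) 0 z = z⁻¹ * (discExt q.1 z - discExt q.1 0) := by
  rw [dslope_of_ne _ hz, slope]; simp

lemma HInf_diffAt (q : HInf) : DifferentiableAt ℂ (discExt q.1) 0 :=
  q.2.differentiableAt (ball_mem_nhds _ one_pos)

def HInf_S : HInf →L[ℝ] HInf :=
  LinearMap.mkContinuous
    { toFun := fun q => HInf_mk (dslope (discExt q.1) 0) (dslope_ball_diff q) (2 * ‖q‖)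
        (fun z hz => HInf_dslope_le q hz)
      map_add' := by
        intro p q
        apply HInf_ext
        intro z hz
        refine Eq.trans ?_ (congrFun (discExt_add _ _) z).symm
        rw [Pi.add_apply, HInf_mk_apply _ _ _ _ hz, HInf_mk_apply _ _ _ _ hz,
          HInf_mk_apply _ _ _ _ hz]
        change dslope (discExt (p.1 + q.1)) 0 z = _
        rw [discExt_add]
        by_cases h0 : z = 0
        · subst h0
          simp only [dslope_same]
          exact deriv_add (HInf_diffAt p) (HInf_diffAt q)
        · rw [dslope_of_ne _ h0, dslope_of_ne _ h0, dslope_of_ne _ h0]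
          simp [slope]; ring
      map_smul' := by
        intro c q
        apply HInf_ext
        intro z hz
        simp only [RingHom.id_apply]
        refine Eq.trans ?_ (congrFun (discExt_smul _ _) z).symm
        rw [Pi.smul_apply, HInf_mk_apply _ _ _ _ hz, HInf_mk_apply _ _ _ _ hz]
        change dslope (discExt (c • q.1)) 0 z = _
        rw [discExt_smul]
        by_cases h0 : z = 0
        · subst h0
          simp only [dslope_same]
          exact deriv_const_smul _ (HInf_diffAt q)
        · rw [dslope_of_ne _ h0, dslope_of_ne _ h0]
          simp [slope]; ring } 2 (fun q => by
    exact HInf_mk_norm_le (dslope (discExt q.1) 0) (dslope_ball_diff q) (2 * ‖q‖) (by positivity)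
      (fun z hz => HInf_dslope_le q hz))

open scoped Classical in
def HInf_chi (t : ℝ) : HInf →ₐ[ℝ] ℂ :=
  if h : (t : ℂ) ∈ ball (0:ℂ) 1 then
    { toFun := fun q => q.1 ⟨t, h⟩
      map_one' := rfl
      map_mul' := fun _ _ => rfl
      map_zero' := rfl
      map_add' := fun _ _ => rfl
      commutes' := fun _ => rfl }
  else
    { toFun := fun q => q.1 ⟨0, by simp⟩
      map_one' := rfl
      map_mul' := fun _ _ => rfl
      map_zero' := rfl
      map_add' := fun _ _ => rfl
      commutes' := fun _ => rfl }

lemma HInf_chi_apply {t : ℝ} (h : |t| < 1) (q : HInf) : HInf_chi t q = discExt q.1 t := by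
  have h' : (t:ℂ) ∈ ball (0:ℂ) 1 := by simpa using h
  rw [discExt_of_mem _ h', HInf_chi, dif_pos h']; rfl

def HInf_z : HInf := HInf_mk (fun z => z) differentiableOn_id 1 (fun z hz => by
  have : ‖z‖ < 1 := by simpa using hz
  exact this.le)

def HInf_kappa : ℂ →ₐ[ℝ] HInf where
  toFun c := HInf_mk (fun _ => c) (differentiableOn_const _) ‖c‖ (fun _ _ => le_rfl)
  map_one' := rfl
  map_mul' _ _ := rfl
  map_zero' := rfl
  map_add' _ _ := rfl
  commutes' _ := rfl

lemma HInf_chi_norm (t : ℝ) (q : HInf) : ‖HInf_chi t q‖ ≤ ‖q‖ := by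
  rw [HInf_chi]; split_ifs
  · exact BoundedContinuousFunction.norm_coe_le_norm q.1 _
  · exact BoundedContinuousFunction.norm_coe_le_norm q.1 _

lemma HInf_uniq {p q : HInf} (h : ∀ t : ℝ, |t| < 1 → HInf_chi t p = HInf_chi t q) : p = q := by
  apply HInf_ext
  have hp : AnalyticOnNhd ℂ (discExt p.1) (ball 0 1) := DifferentiableOn.analyticOnNhd p.2 isOpen_ball
  have hq : AnalyticOnNhd ℂ (discExt q.1) (ball 0 1) := DifferentiableOn.analyticOnNhd q.2 isOpen_ball
  refine hp.eqOn_of_preconnected_of_frequently_eq hq (convex_ball _ _).isPreconnected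
    (z₀ := 0) (by simp) ?_
  have h1 : Filter.Tendsto (fun t : ℝ => (t:ℂ)) (𝓝[≠] 0) (𝓝[≠] 0) := by
    refine tendsto_nhdsWithin_iff.2 ⟨?_, ?_⟩
    · have : Filter.Tendsto (fun t : ℝ => (t:ℂ)) (𝓝 0) (𝓝 ((0:ℝ):ℂ)) :=
        Complex.continuous_ofReal.tendsto 0
      simpa using this.mono_left nhdsWithin_le_nhds
    · filter_upwards [self_mem_nhdsWithin] with t ht
      simpa using ht
  apply h1.frequently
  apply Filter.Eventually.frequently
  have : ∀ᶠ t : ℝ in 𝓝 0, |t| < 1 := by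
    have := ball_mem_nhds (0:ℝ) one_pos
    filter_upwards [this] with t ht
    simpa using ht
  filter_upwards [nhdsWithin_le_nhds this] with t ht
  rw [← HInf_chi_apply ht, ← HInf_chi_apply ht, h t ht]

/-- The data extracted from the Hardy algebra. -/
theorem HInf_data :
    (∀ t q, ‖HInf_chi t q‖ ≤ ‖q‖) ∧ (∀ t : ℝ, |t| < 1 → HInf_chi t HInf_z = t) ∧
    (∀ q, q = HInf_kappa (HInf_chi 0 q) + HInf_z * HInf_S q) ∧
    (∀ t : ℝ, |t| < 1 → ∀ c, HInf_chi t (HInf_kappa c) = c) ∧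
    (∀ p q, (∀ t : ℝ, |t| < 1 → HInf_chi t p = HInf_chi t q) → p = q) := by
  refine ⟨HInf_chi_norm, ?_, ?_, ?_, fun p q => HInf_uniq⟩
  · intro t ht
    rw [HInf_chi_apply ht]
    exact HInf_mk_apply _ _ _ _ (by simpa using ht)
  · intro q
    have hk : ∀ c (t : ℝ), |t| < 1 → HInf_chi t (HInf_kappa c) = c := by
      intro c t ht
      rw [HInf_chi_apply ht]
      exact HInf_mk_apply _ _ _ _ (by simpa using ht)
    apply HInf_uniq
    intro t ht
    rw [map_add, map_mul, hk _ _ ht]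
    rw [HInf_chi_apply ht, HInf_chi_apply (by simp), HInf_chi_apply ht, HInf_chi_apply ht]
    have hz : (t:ℂ) ∈ ball (0:ℂ) 1 := by simpa using ht
    rw [show discExt (HInf_z).1 t = t from HInf_mk_apply _ _ _ _ hz]
    rw [show discExt (HInf_S q).1 t = dslope (discExt q.1) 0 t from
      HInf_mk_apply _ (dslope_ball_diff q) (2 * ‖q‖) (fun z hz => HInf_dslope_le q hz) hz]
    by_cases h0 : t = 0
    · subst h0; simp
    · have h0' : (t:ℂ) ≠ 0 := by exact_mod_cast h0
      rw [dslope_eq q h0']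
      simp; field_simp; ring
  · intro t ht c
    rw [HInf_chi_apply ht]
    exact HInf_mk_apply _ _ _ _ (by simpa using ht)


section ext
variable {A : Type} [NormedCommRing A] [NormedAlgebra ℝ A]
  {E : Type} [NormedAddCommGroup E] [NormedSpace ℝ E] {ι : Type} [Fintype ι]

def extTerm (v : ι → E) (p : FormalMultilinearSeries ℝ E ℝ) (k : ℕ) (j : Fin k → ι) :
    ContinuousMultilinearMap ℝ (fun _ : Fin k => ι → A) A :=
  (p k (fun i => v (j i))) • (ContinuousMultilinearMap.mkPiAlgebra ℝ (Fin k) A).compContinuousLinearMap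
    (fun i => ContinuousLinearMap.proj (R := ℝ) (φ := fun _ : ι => A) (j i))

def extSeries (v : ι → E) (p : FormalMultilinearSeries ℝ E ℝ) :
    FormalMultilinearSeries ℝ (ι → A) A :=
  fun k => ∑ j : Fin k → ι, extTerm v p k j

lemma extSeries_apply (v : ι → E) (p : FormalMultilinearSeries ℝ E ℝ) (k : ℕ) (a : ι → A) :
    extSeries v p k (fun _ => a) = ∑ j : Fin k → ι, (p k (fun i => v (j i))) • ∏ i, a (j i) := by
  simp [extSeries, extTerm]

lemma extSeries_char (v : ι → E) (p : FormalMultilinearSeries ℝ E ℝ) (k : ℕ) (a : ι → A)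
    (χ : A →ₐ[ℝ] ℂ) (y : ι → ℝ) (hy : ∀ i, χ (a i) = y i) :
    χ (extSeries v p k (fun _ => a)) = ((p k (fun _ => ∑ i, y i • v i) : ℝ) : ℂ) := by
  rw [extSeries_apply, map_sum, ContinuousMultilinearMap.map_sum]
  push_cast
  apply Finset.sum_congr rfl
  intro j _
  rw [map_smul, map_prod, ContinuousMultilinearMap.map_smul_univ]
  simp only [hy]
  rw [Complex.real_smul, smul_eq_mul]
  push_cast
  ring

lemma extTerm_norm (v : ι → E) (p : FormalMultilinearSeries ℝ E ℝ) (k : ℕ) (j : Fin k → ι) :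
    ‖(extTerm v p k j : ContinuousMultilinearMap ℝ (fun _ : Fin k => ι → A) A)‖
      ≤ (‖p k‖ * ‖v‖ ^ k) * max ‖(1:A)‖ 1 := by
  apply ContinuousMultilinearMap.opNorm_le_bound (by positivity)
  intro m
  simp only [extTerm, smul_apply,
    ContinuousMultilinearMap.compContinuousLinearMap_apply, ContinuousMultilinearMap.mkPiAlgebra_apply,
    ContinuousLinearMap.proj_apply]
  rw [norm_smul]
  have h1 : ‖p k (fun i => v (j i))‖ ≤ ‖p k‖ * ‖v‖ ^ k := by
    refine ((p k).le_opNorm _).trans ?_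
    gcongr
    calc ∏ i, ‖v (j i)‖ ≤ ∏ i : Fin k, ‖v‖ := by
          apply Finset.prod_le_prod (fun _ _ => norm_nonneg _) (fun i _ => norm_le_pi_norm v _)
      _ = _ := by simp
  have h2 : ‖∏ i, m i (j i)‖ ≤ max ‖(1:A)‖ 1 * ∏ i, ‖m i‖ := by
    rcases Nat.eq_zero_or_pos k with rfl | hk
    · simp
    · have : (Finset.univ : Finset (Fin k)).Nonempty := ⟨⟨0, hk⟩, Finset.mem_univ _⟩
      calc ‖∏ i, m i (j i)‖ ≤ ∏ i, ‖m i (j i)‖ := Finset.norm_prod_le' _ this _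
        _ ≤ ∏ i, ‖m i‖ := Finset.prod_le_prod (fun _ _ => norm_nonneg _)
            (fun i _ => norm_le_pi_norm (m i) _)
        _ ≤ _ := le_mul_of_one_le_left (Finset.prod_nonneg fun _ _ => norm_nonneg _) (le_max_right _ _)
  calc _ ≤ (‖p k‖ * ‖v‖ ^ k) * (max ‖(1:A)‖ 1 * ∏ i, ‖m i‖) := by gcongr
    _ = _ := by ring

lemma extSeries_radius (v : ι → E) (p : FormalMultilinearSeries ℝ E ℝ) (hp : 0 < p.radius) :
    0 < (extSeries v p : FormalMultilinearSeries ℝ (ι → A) A).radius := by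
  obtain ⟨C, r, hC, hr, h⟩ := p.le_mul_pow_of_radius_pos hp
  set D : ℝ := (Fintype.card ι) * ‖v‖ * r + 1 with hD
  have hDpos : 0 < D := by positivity
  have : ((D⁻¹).toNNReal : ENNReal) ≤ (extSeries v p : FormalMultilinearSeries ℝ (ι → A) A).radius := by
    apply FormalMultilinearSeries.le_radius_of_bound (C := C * max ‖(1:A)‖ 1)
    intro k
    rw [Real.coe_toNNReal _ (by positivity)]
    have h1 : ‖(extSeries v p k : ContinuousMultilinearMap ℝ (fun _ : Fin k => ι → A) A)‖
        ≤ (Fintype.card ι)^k * ((C * r ^ k * ‖v‖ ^ k) * max ‖(1:A)‖ 1) := by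
      calc _ ≤ ∑ j : Fin k → ι, ‖(extTerm v p k j : ContinuousMultilinearMap ℝ (fun _ : Fin k => ι → A) A)‖ :=
            norm_sum_le _ _
        _ ≤ ∑ j : Fin k → ι, (C * r ^ k * ‖v‖ ^ k) * max ‖(1:A)‖ 1 := by
            apply Finset.sum_le_sum
            intro j _
            refine (extTerm_norm v p k j).trans ?_
            gcongr
            exact h k
        _ = _ := by simp
    calc _ ≤ ((Fintype.card ι)^k * ((C * r ^ k * ‖v‖ ^ k) * max ‖(1:A)‖ 1)) * D⁻¹ ^ k := by gcongr
      _ = (C * max ‖(1:A)‖ 1) * (((Fintype.card ι) * ‖v‖ * r) * D⁻¹) ^ k := by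
        rw [mul_pow, mul_pow, mul_pow]; ring
      _ ≤ (C * max ‖(1:A)‖ 1) * 1 := by
        gcongr
        apply pow_le_one₀ (by positivity)
        rw [mul_inv_le_iff₀ hDpos]
        linarith
      _ = _ := mul_one _
  refine lt_of_lt_of_le ?_ this
  simpa using hDpos

theorem exists_ext [CompleteSpace A] (v : ι → E) (f : E → ℝ) (hf : AnalyticAt ℝ f 0) :
    ∃ F : (ι → A) → A, AnalyticAt ℝ F 0 ∧ ∀ᶠ a in 𝓝 (0 : ι → A), ∀ χ : A →ₐ[ℝ] ℂ,
      (∀ q, ‖χ q‖ ≤ ‖q‖) → ∀ y : ι → ℝ, (∀ i, χ (a i) = y i) →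
      χ (F a) = ((f (∑ i, y i • v i) : ℝ) : ℂ) := by
  obtain ⟨p, r, hp⟩ := hf
  have hP := (extSeries v p : FormalMultilinearSeries ℝ (ι → A) A).hasFPowerSeriesOnBall
    (extSeries_radius v p (hp.r_pos.trans_le hp.r_le))
  refine ⟨_, hP.analyticAt, ?_⟩
  have h1 := Metric.eball_mem_nhds (0 : ι → A) hP.r_pos
  have hcont : Filter.Tendsto (fun y : ι → ℝ => ∑ i, y i • v i) (𝓝 0) (𝓝 0) := by
    have : Continuous (fun y : ι → ℝ => ∑ i, y i • v i) := by fun_prop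
    simpa using this.tendsto 0
  have h2 := hcont (Metric.eball_mem_nhds (0:E) hp.r_pos)
  obtain ⟨ε, hε, h2⟩ := Metric.mem_nhds_iff.1 h2
  filter_upwards [h1, Metric.ball_mem_nhds _ hε] with a ha haε χ hχ y hy
  have hy' : y ∈ ball (0 : ι → ℝ) ε := by
    rw [mem_ball_zero_iff] at haε ⊢
    refine lt_of_le_of_lt ?_ haε
    rw [pi_norm_le_iff_of_nonneg (norm_nonneg _)]
    intro i
    calc ‖y i‖ = ‖(χ (a i))‖ := by rw [hy]; simp
      _ ≤ ‖a i‖ := hχ _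
      _ ≤ _ := norm_le_pi_norm a i
  have s1 := hP.hasSum (y := a) ha
  have s2 := hp.hasSum (y := ∑ i, y i • v i) (h2 hy')
  let χc : A →L[ℝ] ℂ := LinearMap.mkContinuous χ.toLinearMap 1 (by simpa using hχ)
  have s3 := χc.hasSum s1
  have s4 := Complex.ofRealCLM.hasSum s2
  have : ∀ k, χc (extSeries v p k (fun _ => a)) = Complex.ofRealCLM (p k (fun _ => ∑ i, y i • v i)) :=
    fun k => extSeries_char v p k a χ y hy
  simp only [this, zero_add] at s3 s4
  exact s3.unique s4
end ext

lemma analyticAt_clm_apply' {X Y Z : Type*} [NormedAddCommGroup X] [NormedSpace ℝ X]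
    [NormedAddCommGroup Y] [NormedSpace ℝ Y] [NormedAddCommGroup Z] [NormedSpace ℝ Z]
    {f : X → (Y →L[ℝ] Z)} {g : X → Y} {x : X} (hf : AnalyticAt ℝ f x) (hg : AnalyticAt ℝ g x) :
    AnalyticAt ℝ (fun x => f x (g x)) x := by
  have h := (ContinuousLinearMap.id ℝ (Y →L[ℝ] Z)).analyticAt_bilinear (f x, g x)
  exact AnalyticAt.comp (f := fun x => (f x, g x)) (x := x) h (hf.prod hg)

section division
variable {A : Type} [NormedCommRing A] [NormedAlgebra ℝ A] [CompleteSpace A]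

lemma shift_iter (z0 : A) (S : A →L[ℝ] A) (χ0 : A →ₐ[ℝ] ℂ) (κ : ℂ →ₐ[ℝ] A)
    (h3 : ∀ q, q = κ (χ0 q) + z0 * S q) (d : ℕ) (q : A) :
    q = (∑ i ∈ Finset.range d, κ (χ0 ((S ^ i) q)) * z0 ^ i) + z0 ^ d * (S ^ d) q := by
  induction d with
  | zero => simp
  | succ d ih =>
    have hS : (S ^ (d+1)) q = S ((S ^ d) q) := by rw [pow_succ']; rfl
    rw [Finset.sum_range_succ, hS]
    calc q = _ := ih
      _ = (∑ i ∈ Finset.range d, κ (χ0 ((S ^ i) q)) * z0 ^ i)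
          + z0 ^ d * (κ (χ0 ((S ^ d) q)) + z0 * S ((S ^ d) q)) := by rw [← h3]
      _ = _ := by ring

lemma char_eq (z0 : A) (S : A →L[ℝ] A) (χ : ℝ → A →ₐ[ℝ] ℂ) (κ : ℂ →ₐ[ℝ] A)
    (h2 : ∀ t : ℝ, |t| < 1 → χ t z0 = t)
    (h3 : ∀ q, q = κ (χ 0 q) + z0 * S q)
    (h4 : ∀ t : ℝ, |t| < 1 → ∀ c, χ t (κ c) = c) (t : ℝ) (ht : |t| < 1)
    (hu : IsUnit (1 - t • S)) (q : A) : χ t q = χ 0 (Ring.inverse (1 - t • S) q) := by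
  set w := Ring.inverse (1 - t • S) q with hw
  have : q = w - t • S w := by
    have : (1 - t • S) * Ring.inverse (1 - t • S) = 1 := Ring.mul_inverse_cancel _ hu
    have := congrArg (fun L : A →L[ℝ] A => L q) this
    simpa using this.symm
  have hw3 := congrArg (χ t) (h3 w)
  rw [map_add, map_mul, h4 t ht, h2 t ht] at hw3
  rw [this, map_sub, map_smul, Complex.real_smul, hw3]
  ring

theorem division_aux {n : ℕ} (z0 : A) (S : A →L[ℝ] A) (χ : ℝ → A →ₐ[ℝ] ℂ) (κ : ℂ →ₐ[ℝ] A)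
    (h1 : ∀ t q, ‖χ t q‖ ≤ ‖q‖) (h2 : ∀ t : ℝ, |t| < 1 → χ t z0 = t)
    (h3 : ∀ q, q = κ (χ 0 q) + z0 * S q)
    (h4 : ∀ t : ℝ, |t| < 1 → ∀ c, χ t (κ c) = c)
    (h5 : ∀ p q, (∀ t : ℝ, |t| < 1 → χ t p = χ t q) → p = q)
    (f : (Fin n → ℝ) × ℝ → ℝ) (hf : AnalyticAt ℝ f 0)
    (hreg : ¬ ∀ᶠ t in 𝓝 (0:ℝ), f (0, t) = 0) :
    ∃ d : ℕ, ∀ g : (Fin n → ℝ) × ℝ → ℝ, AnalyticAt ℝ g 0 →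
      ∃ Q : (Fin n → ℝ) × ℝ → ℝ, AnalyticAt ℝ Q 0 ∧ ∃ R : ℕ → (Fin n → ℝ) → ℝ,
        (∀ i, AnalyticAt ℝ (R i) 0) ∧
        ∀ᶠ z in 𝓝 (0 : (Fin n → ℝ) × ℝ),
          g z = Q z * f z + ∑ i ∈ Finset.range d, R i z.1 * z.2 ^ i := by
  -- regularity in the last variable
  have hf0 : AnalyticAt ℝ (fun t : ℝ => f (0, t)) 0 := by
    have hf' : AnalyticAt ℝ f ((fun t : ℝ => ((0 : Fin n → ℝ), t)) 0) := hf
    exact hf'.comp (f := fun t : ℝ => ((0 : Fin n → ℝ), t)) (analyticAt_const.prod analyticAt_id)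
  obtain ⟨d, u0, hu0, hu0ne, hfu⟩ := hf0.exists_eventuallyEq_pow_smul_nonzero_iff.2 hreg
  refine ⟨d, fun g hg => ?_⟩
  -- extensions
  let v : Option (Fin n) → (Fin n → ℝ) × ℝ := fun o => o.elim (0, 1) (fun i => (Pi.single i 1, 0))
  have hv : ∀ y : Option (Fin n) → ℝ, ∑ o, y o • v o = (fun i => y (some i), y none) := by
    intro y
    rw [Fintype.sum_option]
    ext i
    · simp [v, Prod.fst_sum, Finset.sum_apply, Pi.single_apply]
    · simp [v, Prod.snd_sum]
  obtain ⟨F1, hF1, hF1e⟩ := exists_ext (A := A) v f hf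
  obtain ⟨G1, hG1, hG1e⟩ := exists_ext (A := A) v g hg
  obtain ⟨U1, hU1, hU1e⟩ := exists_ext (A := A) (fun _ : Unit => (1:ℝ)) u0 hu0
  have hU10 : U1 0 = algebraMap ℝ A (u0 0) := by
    apply h5
    intro t ht
    have := hU1e.self_of_nhds (χ t) (h1 t) 0 (by simp)
    rw [this]; simp
  have hU1u : ∀ᶠ a in 𝓝 (0 : Unit → A), IsUnit (U1 a) := by
    have : U1 0 ∈ {x : A | IsUnit x} := by
      rw [hU10]; exact (IsUnit.mk0 _ hu0ne).map _
    exact hU1.continuousAt.eventually_mem (Units.isOpen.mem_nhds this)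
  -- base point
  let base : (Fin n → ℝ) → A → (Option (Fin n) → A) :=
    fun x τ o => o.elim τ (fun i => algebraMap ℝ A (x i))
  have hb1 : Continuous (fun ρ : ℝ => base 0 (ρ • z0)) := by
    apply continuous_pi
    rintro (_ | i)
    · change Continuous (fun ρ : ℝ => ρ • z0); fun_prop
    · exact continuous_const
  have hb1' : Filter.Tendsto (fun ρ : ℝ => base 0 (ρ • z0)) (𝓝[>] 0) (𝓝 0) := by
    have := hb1.tendsto 0
    have h0 : base 0 ((0:ℝ) • z0) = 0 := by
      ext o; cases o <;> simp [base]
    rw [h0] at this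
    exact this.mono_left nhdsWithin_le_nhds
  have hb2' : Filter.Tendsto (fun ρ : ℝ => (fun _ : Unit => ρ • z0)) (𝓝[>] 0) (𝓝 0) := by
    have : Continuous (fun ρ : ℝ => (fun _ : Unit => ρ • z0)) := by fun_prop
    have := this.tendsto 0
    have h0 : (fun _ : Unit => (0:ℝ) • z0) = 0 := by ext; simp
    rw [h0] at this
    exact this.mono_left nhdsWithin_le_nhds
  obtain ⟨ε, hε, hfu'⟩ := Metric.eventually_nhds_iff.1 hfu
  have hρε : ∀ᶠ ρ : ℝ in 𝓝[>] 0, ρ < ε := nhdsWithin_le_nhds (Iio_mem_nhds hε)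
  obtain ⟨ρ, ⟨⟨⟨⟨⟨⟨hFan, hFev⟩, hGan⟩, hGev⟩, hUu⟩, hUev⟩, hρlt⟩, hρ⟩ :=
    (((((((hb1'.eventually hF1.eventually_analyticAt).and
      (hb1'.eventually (eventually_eventually_nhds.2 hF1e))).and
      (hb1'.eventually hG1.eventually_analyticAt)).and
      (hb1'.eventually (eventually_eventually_nhds.2 hG1e))).and
      (hb2'.eventually hU1u)).and (hb2'.eventually hU1e)).and hρε).and
      self_mem_nhdsWithin |>.exists
  have hρ : 0 < ρ := hρ
  set τ := ρ • z0 with hτ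
  have hχτ : ∀ t : ℝ, |t| < 1 → χ t τ = ((ρ * t : ℝ) : ℂ) := by
    intro t ht
    rw [hτ, map_smul, h2 t ht, Complex.real_smul]; push_cast; rfl
  have hbase : AnalyticAt ℝ (fun x => base x τ) 0 := by
    apply AnalyticAt.pi
    rintro (_ | i)
    · exact analyticAt_const
    · change AnalyticAt ℝ (fun x : Fin n → ℝ => algebraMap ℝ A (x i)) 0
      exact (((Algebra.linearMap ℝ A).toContinuousLinearMap).comp
        (ContinuousLinearMap.proj (R := ℝ) (φ := fun _ : Fin n => ℝ) i)).analyticAt 0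
  let FA : (Fin n → ℝ) → A := fun x => F1 (base x τ)
  let GA : (Fin n → ℝ) → A := fun x => G1 (base x τ)
  have hFA : AnalyticAt ℝ FA 0 := AnalyticAt.comp (f := fun x => base x τ) (x := 0) hFan hbase
  have hGA : AnalyticAt ℝ GA 0 := AnalyticAt.comp (f := fun x => base x τ) (x := 0) hGan hbase
  have hFAe : ∀ᶠ x in 𝓝 (0 : Fin n → ℝ), ∀ t : ℝ, |t| < 1 → χ t (FA x) = (f (x, ρ * t) : ℝ) := by
    have := hbase.continuousAt.eventually (hFev : ∀ᶠ y in 𝓝 (base 0 τ), _)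
    filter_upwards [this] with x hx t ht
    have := hx (χ t) (h1 t) (fun o => o.elim (ρ * t) x) (by
      rintro (_ | i)
      · exact hχτ t ht
      · simp [base])
    rw [hv] at this
    exact this
  have hGAe : ∀ᶠ x in 𝓝 (0 : Fin n → ℝ), ∀ t : ℝ, |t| < 1 → χ t (GA x) = (g (x, ρ * t) : ℝ) := by
    have := hbase.continuousAt.eventually (hGev : ∀ᶠ y in 𝓝 (base 0 τ), _)
    filter_upwards [this] with x hx t ht
    have := hx (χ t) (h1 t) (fun o => o.elim (ρ * t) x) (by
      rintro (_ | i)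
      · exact hχτ t ht
      · simp [base])
    rw [hv] at this
    exact this
  obtain ⟨u, hu⟩ := hUu
  have hFA0 : FA 0 = τ ^ d * u := by
    apply h5
    intro t ht
    rw [hFAe.self_of_nhds t ht, map_mul, map_pow, hχτ t ht]
    have hut := hUev (χ t) (h1 t) (fun _ => ρ * t) (fun _ => hχτ t ht)
    rw [hu, hut]
    have h6 := hfu' (y := ρ * t) (by
      rw [dist_zero_right, norm_mul, Real.norm_eq_abs, Real.norm_eq_abs, abs_of_pos hρ]
      nlinarith [abs_nonneg t])
    rw [h6]
    simp
  -- the operator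
  let uinv : A := ((u⁻¹ : Aˣ) : A)
  let L0 : A →L[ℝ] A := (ContinuousLinearMap.mul ℝ A uinv).comp ((ρ ^ d)⁻¹ • S ^ d)
  let B : (Fin n → ℝ) → (A →L[ℝ] A) :=
    fun x => 1 + (ContinuousLinearMap.mul ℝ A (FA x - FA 0)).comp L0
  have hBan : AnalyticAt ℝ B 0 := by
    have e1 : AnalyticAt ℝ (fun x => FA x - FA 0) 0 := hFA.sub analyticAt_const
    let Λ : A →L[ℝ] (A →L[ℝ] A) :=
      ((ContinuousLinearMap.compL ℝ A A A).flip L0).comp (ContinuousLinearMap.mul ℝ A)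
    have e2 : AnalyticAt ℝ (fun x => Λ (FA x - FA 0)) 0 :=
      AnalyticAt.comp (f := fun x => FA x - FA 0) (x := 0) (Λ.analyticAt _) e1
    exact analyticAt_const.add e2
  have hB0 : B 0 = 1 := by simp [B]
  have hBapp : ∀ x q, B x q = FA x * L0 q + ∑ i ∈ Finset.range d, κ (χ 0 ((S ^ i) q)) * z0 ^ i := by
    intro x q
    have e1 : FA 0 * L0 q = z0 ^ d * (S ^ d) q := by
      rw [hFA0]
      change τ ^ d * u * (uinv * ((ρ ^ d)⁻¹ • (S ^ d) q)) = _
      rw [hτ, smul_pow]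
      have : (u : A) * uinv = 1 := u.mul_inv
      calc _ = (u * uinv) * ((ρ ^ d • z0 ^ d) * ((ρ ^ d)⁻¹ • (S ^ d) q)) := by ring
        _ = _ := by
          rw [this, one_mul, smul_mul_smul_comm, mul_inv_cancel₀ (by positivity), one_smul]
    have e2 := shift_iter z0 S (χ 0) κ h3 d q
    change q + (FA x - FA 0) * L0 q = _
    rw [sub_mul, e1]
    nth_rewrite 1 [e2]
    ring
  have hBinv : AnalyticAt ℝ (fun x => Ring.inverse (B x)) 0 := by
    have : AnalyticAt ℝ (Ring.inverse : (A →L[ℝ] A) → _) (B 0) := by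
      rw [hB0]; exact analyticAt_inverse (𝕜 := ℝ) (1 : (A →L[ℝ] A)ˣ)
    exact this.comp hBan
  have hBunit : ∀ᶠ x in 𝓝 (0 : Fin n → ℝ), IsUnit (B x) := by
    have : B 0 ∈ {x : A →L[ℝ] A | IsUnit x} := by rw [hB0]; exact isUnit_one
    exact hBan.continuousAt.eventually_mem (Units.isOpen.mem_nhds this)
  let q : (Fin n → ℝ) → A := fun x => Ring.inverse (B x) (GA x)
  have hq : AnalyticAt ℝ q 0 := analyticAt_clm_apply' hBinv hGA
  have hqe : ∀ᶠ x in 𝓝 (0 : Fin n → ℝ), B x (q x) = GA x := by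
    filter_upwards [hBunit] with x hx
    have : B x * Ring.inverse (B x) = 1 := Ring.mul_inverse_cancel _ hx
    exact congrArg (fun L : A →L[ℝ] A => L (GA x)) this
  let χc : A →L[ℝ] ℂ := LinearMap.mkContinuous (χ 0).toLinearMap 1 (by simpa using h1 0)
  -- evaluation of the quotient
  let opS : (Fin n → ℝ) × ℝ → (A →L[ℝ] A) := fun z => Ring.inverse (1 - (z.2 / ρ) • S)
  have hsm : AnalyticAt ℝ (fun z : (Fin n → ℝ) × ℝ => (1 : A →L[ℝ] A) - (z.2 / ρ) • S) 0 := by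
    have e1 : AnalyticAt ℝ (fun z : (Fin n → ℝ) × ℝ => z.2 / ρ) 0 := analyticAt_snd.div_const
    have e2 : AnalyticAt ℝ (fun z : (Fin n → ℝ) × ℝ => (z.2 / ρ) • S) 0 :=
      e1.smul analyticAt_const
    exact analyticAt_const.sub e2
  have hsm0 : (1 : A →L[ℝ] A) - ((0 : (Fin n → ℝ) × ℝ).2 / ρ) • S = 1 := by
    rw [Prod.snd_zero, zero_div]
    rw [zero_smul ℝ S, sub_zero]
  have hopS : AnalyticAt ℝ opS 0 := by
    have : AnalyticAt ℝ (Ring.inverse : (A →L[ℝ] A) → _)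
        ((fun z : (Fin n → ℝ) × ℝ => (1 : A →L[ℝ] A) - (z.2 / ρ) • S) 0) := by
      have e : (fun z : (Fin n → ℝ) × ℝ => (1 : A →L[ℝ] A) - (z.2 / ρ) • S) 0 = 1 := hsm0
      rw [e]; exact analyticAt_inverse (𝕜 := ℝ) (1 : (A →L[ℝ] A)ˣ)
    exact AnalyticAt.comp (f := fun z : (Fin n → ℝ) × ℝ => (1 : A →L[ℝ] A) - (z.2 / ρ) • S)
      (x := 0) this hsm
  have hunitS : ∀ᶠ z in 𝓝 (0 : (Fin n → ℝ) × ℝ), IsUnit ((1 : A →L[ℝ] A) - (z.2 / ρ) • S) := by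
    have : (fun z : (Fin n → ℝ) × ℝ => (1 : A →L[ℝ] A) - (z.2 / ρ) • S) 0
        ∈ {x : A →L[ℝ] A | IsUnit x} := by simp only [hsm0]; exact isUnit_one
    exact hsm.continuousAt.eventually_mem (Units.isOpen.mem_nhds this)
  have hq1 : AnalyticAt ℝ (fun z : (Fin n → ℝ) × ℝ => q z.1) 0 :=
    AnalyticAt.comp (f := fun z : (Fin n → ℝ) × ℝ => z.1) (x := 0) hq analyticAt_fst
  have hQ1 : AnalyticAt ℝ (fun z : (Fin n → ℝ) × ℝ => L0 (q z.1)) 0 :=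
    AnalyticAt.comp (f := fun z : (Fin n → ℝ) × ℝ => q z.1) (x := 0) (L0.analyticAt _) hq1
  refine ⟨fun z => (χ 0 (opS z (L0 (q z.1)))).re, ?_,
    fun i x => (χ 0 ((S ^ i) (q x))).re / ρ ^ i, ?_, ?_⟩
  · have e1 : AnalyticAt ℝ (fun z : (Fin n → ℝ) × ℝ => opS z (L0 (q z.1))) 0 := analyticAt_clm_apply' hopS hQ1
    exact AnalyticAt.comp (f := fun z : (Fin n → ℝ) × ℝ => opS z (L0 (q z.1))) (x := 0)
      ((Complex.reCLM.comp χc).analyticAt _) e1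
  · intro i
    have : AnalyticAt ℝ (fun x => ((Complex.reCLM.comp χc).comp (S ^ i)) (q x)) 0 :=
      AnalyticAt.comp (f := q) (x := 0) (((Complex.reCLM.comp χc).comp (S ^ i)).analyticAt _) hq
    exact this.div_const
  · have ht : ∀ᶠ z in 𝓝 (0 : (Fin n → ℝ) × ℝ), |z.2 / ρ| < 1 := by
      have : Continuous (fun z : (Fin n → ℝ) × ℝ => |z.2 / ρ|) := by fun_prop
      have := this.tendsto 0
      simp only [Prod.snd_zero, zero_div, abs_zero] at this
      exact this.eventually (Iio_mem_nhds one_pos)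
    have hfst : Filter.Tendsto (fun z : (Fin n → ℝ) × ℝ => z.1) (𝓝 0) (𝓝 0) := by
      exact continuous_fst.tendsto 0
    filter_upwards [ht, hunitS, hfst.eventually hFAe, hfst.eventually hGAe, hfst.eventually hqe]
      with z hz hzu hzF hzG hzq
    have e1 := congrArg (χ (z.2 / ρ)) ((hzq.symm.trans (hBapp z.1 (q z.1))))
    rw [map_add, map_mul, hzF _ hz, hzG _ hz, map_sum,
      char_eq z0 S χ κ h2 h3 h4 _ hz hzu (L0 (q z.1))] at e1
    have hcan : ρ * (z.2 / ρ) = z.2 := by field_simp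
    simp only [map_mul, map_pow, h4 _ hz, h2 _ hz, hcan] at e1
    have e2 := congrArg Complex.re e1
    have e3 : ∀ (c : ℂ) (r : ℝ), (c * (r:ℂ)).re = c.re * r := by intro c r; simp
    rw [Complex.ofReal_re, Complex.add_re, Complex.re_ofReal_mul, Complex.re_sum] at e2
    rw [show ((z.1, z.2) : (Fin n → ℝ) × ℝ) = z from rfl] at e2
    rw [e2, mul_comm]
    congr 1
    apply Finset.sum_congr rfl
    intro i _
    rw [← Complex.ofReal_pow, e3, div_pow]
    ring
end division

theorem weierstrass_division {n : ℕ}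
    (f : (Fin n → ℝ) × ℝ → ℝ) (hf : AnalyticAt ℝ f 0)
    (hreg : ¬ ∀ᶠ t in 𝓝 (0:ℝ), f (0, t) = 0) :
    ∃ d : ℕ, ∀ g : (Fin n → ℝ) × ℝ → ℝ, AnalyticAt ℝ g 0 →
      ∃ Q : (Fin n → ℝ) × ℝ → ℝ, AnalyticAt ℝ Q 0 ∧ ∃ R : ℕ → (Fin n → ℝ) → ℝ,
        (∀ i, AnalyticAt ℝ (R i) 0) ∧
        ∀ᶠ z in 𝓝 (0 : (Fin n → ℝ) × ℝ),
          g z = Q z * f z + ∑ i ∈ Finset.range d, R i z.1 * z.2 ^ i :=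
  division_aux HInf_z HInf_S HInf_chi HInf_kappa HInf_data.1 HInf_data.2.1 HInf_data.2.2.1
    HInf_data.2.2.2.1 HInf_data.2.2.2.2 f hf hreg

section algebra
open Polynomial

variable {O L B : Type*} [CommRing O] [Field L] [CommRing B]

lemma exists_minpol (φ : O →+* L) (b : L) (h : ∃ P : O[X], P.map φ ≠ 0 ∧ P.eval₂ φ b = 0) :
    ∃ W : O[X], W.eval₂ φ b = 0 ∧ φ W.leadingCoeff ≠ 0 ∧ 1 ≤ W.natDegree ∧
      ∀ R : O[X], R.eval₂ φ b = 0 → R.natDegree < W.natDegree → R.map φ = 0 := by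
  classical
  have h' : ∃ k, ∃ P : O[X], P.natDegree = k ∧ P.map φ ≠ 0 ∧ P.eval₂ φ b = 0 := by
    obtain ⟨P, h1, h2⟩ := h; exact ⟨_, P, rfl, h1, h2⟩
  obtain ⟨W, hk, hW1, hW2⟩ := Nat.find_spec h'
  have hmin : ∀ R : O[X], R.eval₂ φ b = 0 → R.natDegree < W.natDegree → R.map φ = 0 := by
    intro R hR hlt
    by_contra hne
    rw [hk] at hlt
    exact Nat.find_min h' hlt ⟨R, rfl, hne, hR⟩
  have hdeg : 1 ≤ W.natDegree := by
    by_contra hlt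
    have h0 : W.natDegree = 0 := by omega
    rw [eq_C_of_natDegree_eq_zero h0] at hW1 hW2
    rw [eval₂_C] at hW2
    rw [map_C, hW2] at hW1
    simp at hW1
  have hl : φ W.leadingCoeff ≠ 0 := by
    intro h0
    have he : W.eraseLead.map φ = W.map φ := by
      conv_rhs => rw [← eraseLead_add_monomial_natDegree_leadingCoeff W]
      rw [Polynomial.map_add, map_monomial, h0]; simp
    apply hW1
    rw [← he]
    apply hmin
    · rw [eval₂_eq_eval_map, he, ← eval₂_eq_eval_map, hW2]
    · have := eraseLead_natDegree_le W
      omega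
  exact ⟨W, hW2, hl, hdeg, hmin⟩

lemma minpol_deriv_ne [CharZero L] (φ : O →+* L) (b : L) (W : O[X])
    (hl : φ W.leadingCoeff ≠ 0) (hd : 1 ≤ W.natDegree)
    (hmin : ∀ R : O[X], R.eval₂ φ b = 0 → R.natDegree < W.natDegree → R.map φ = 0) :
    W.derivative.eval₂ φ b ≠ 0 := by
  intro h0
  have h1 := hmin _ h0 (natDegree_derivative_lt (by omega))
  have h2 := congrArg (fun p : L[X] => p.coeff (W.natDegree - 1)) h1
  simp only [coeff_map, coeff_derivative, coeff_zero, map_mul] at h2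
  rw [Nat.sub_add_cancel hd] at h2
  rcases mul_eq_zero.1 h2 with h | h
  · exact hl h
  · rw [Nat.cast_sub hd] at h
    simp at h
    omega

lemma minpol_lift (φ : O →+* L) (b : L) (W : O[X])
    (hl : φ W.leadingCoeff ≠ 0) (hd : 1 ≤ W.natDegree)
    (hW : W.eval₂ φ b = 0)
    (hmin : ∀ R : O[X], R.eval₂ φ b = 0 → R.natDegree < W.natDegree → R.map φ = 0)
    (ψ : O →+* B) (β : B) (hψ : ∀ c, φ c = 0 → ψ c = 0) (hu : ∀ c, φ c ≠ 0 → IsUnit (ψ c))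
    (hβ : W.eval₂ ψ β = 0) :
    ∀ R : O[X], R.eval₂ φ b = 0 → R.eval₂ ψ β = 0 := by
  suffices H : ∀ n, ∀ R : O[X], R.natDegree = n → R.eval₂ φ b = 0 → R.eval₂ ψ β = 0 from
    fun R => H _ R rfl
  intro n
  induction n using Nat.strong_induction_on with
  | _ n ih =>
    intro R hn hR
    by_cases hlt : R.natDegree < W.natDegree
    · have h0 := hmin R hR hlt
      have h1 : R.map ψ = 0 := by
        ext k
        have := congrArg (fun p : L[X] => p.coeff k) h0
        simp only [coeff_map, coeff_zero] at this ⊢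
        exact hψ _ this
      rw [eval₂_eq_eval_map, h1, eval_zero]
    · push Not at hlt
      set k := R.natDegree - W.natDegree with hk
      set R2 := C W.leadingCoeff * R - C R.leadingCoeff * X ^ k * W with hR2
      have hdeg : R2.natDegree < n := by
        have hle : R2.natDegree ≤ R.natDegree := by
          refine (natDegree_sub_le _ _).trans (max_le (natDegree_C_mul_le _ _) ?_)
          refine natDegree_mul_le.trans ?_
          have := natDegree_C_mul_X_pow_le R.leadingCoeff k
          omega
        have hc : R2.coeff R.natDegree = 0 := by
          rw [hR2, coeff_sub, coeff_C_mul, mul_assoc, coeff_C_mul, coeff_X_pow_mul']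
          rw [if_pos (by omega), show R.natDegree - k = W.natDegree by omega]
          simp only [coeff_natDegree]; ring
        rcases hle.lt_or_eq with h | h
        · omega
        · rw [← h, coeff_natDegree, leadingCoeff_eq_zero] at hc
          rw [hc, natDegree_zero] at h
          omega
      have h2 := ih _ hdeg R2 rfl (by
        rw [hR2, eval₂_sub, eval₂_mul, eval₂_mul, hR, hW]; simp)
      rw [hR2, eval₂_sub, eval₂_mul, eval₂_mul, hβ, eval₂_C, mul_zero, sub_zero] at h2
      exact (hu _ hl).mul_right_eq_zero.1 h2

lemma snd_eval₂ (ψ : O →+* DualNumber L) (φ : O →+* L) (hφ : ∀ c, (ψ c).fst = φ c)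
    (β : DualNumber L) (P : O[X]) :
    (P.eval₂ ψ β).fst = P.eval₂ φ β.fst ∧
    (P.eval₂ ψ β).snd = (∑ k ∈ Finset.range (P.natDegree + 1), (ψ (P.coeff k)).snd * β.fst ^ k)
      + β.snd * P.derivative.eval₂ φ β.fst := by
  constructor
  · have h : (TrivSqZeroExt.fstHom L L L).toRingHom.comp ψ = φ := by
      ext c; exact hφ c
    have := Polynomial.hom_eval₂ P ψ (TrivSqZeroExt.fstHom L L L).toRingHom β
    rw [h] at this
    exact this
  · rw [← Polynomial.sum_over_range (p := P) (f := fun k c => (ψ c).snd * β.fst ^ k) (by simp)]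
    induction P using Polynomial.induction_on' with
    | add p q hp hq =>
      rw [eval₂_add, TrivSqZeroExt.snd_add, hp, hq, derivative_add, eval₂_add,
        Polynomial.sum_add_index _ _ _ (by simp) (by intros; simp [add_mul])]
      ring
    | monomial k c =>
      rw [eval₂_monomial, Polynomial.sum_monomial_index _ _ (by simp), derivative_monomial,
        eval₂_monomial, TrivSqZeroExt.snd_mul, TrivSqZeroExt.fst_pow, TrivSqZeroExt.snd_pow, hφ]
      simp
      ring
end algebra

section germs
open Filter

/-- Functions analytic at the origin. -/
def An (E : Type*) [NormedAddCommGroup E] [NormedSpace ℝ E] : Subring (E → ℝ) where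
  carrier := {f | AnalyticAt ℝ f 0}
  mul_mem' := fun hf hg => AnalyticAt.mul hf hg
  one_mem' := analyticAt_const
  add_mem' := fun hf hg => AnalyticAt.add hf hg
  zero_mem' := analyticAt_const
  neg_mem' := fun hf => AnalyticAt.neg hf

variable {E : Type*} [NormedAddCommGroup E] [NormedSpace ℝ E]
variable {α : Type} (𝒰 : Ultrafilter α)

/-- Evaluation along the ultrafilter. -/
def ev (a : α → E) : An E →+* Germ (𝒰 : Filter α) ℝ where
  toFun f := ((fun i => f.1 (a i) : α → ℝ) : Germ (𝒰 : Filter α) ℝ)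
  map_one' := rfl
  map_mul' _ _ := rfl
  map_zero' := rfl
  map_add' _ _ := rfl

/-- Derivative along a vector field. -/
def Dv (a : α → E) (w : E → E) (f : E → ℝ) : Germ (𝒰 : Filter α) ℝ :=
  ((fun i => fderiv ℝ f (a i) (w (a i)) : α → ℝ) : Germ (𝒰 : Filter α) ℝ)

lemma ev_eq_iff (a : α → E) (f g : An E) :
    ev 𝒰 a f = ev 𝒰 a g ↔ ∀ᶠ i in (𝒰 : Filter α), f.1 (a i) = g.1 (a i) := Germ.coe_eq

lemma ev_eq_zero_iff (a : α → E) (f : An E) :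
    ev 𝒰 a f = 0 ↔ ∀ᶠ i in (𝒰 : Filter α), f.1 (a i) = 0 := Germ.coe_eq

lemma Dv_eq_iff (a : α → E) (w : E → E) (f : E → ℝ) (r : α → ℝ) :
    Dv 𝒰 a w f = (r : Germ (𝒰 : Filter α) ℝ) ↔
      ∀ᶠ i in (𝒰 : Filter α), fderiv ℝ f (a i) (w (a i)) = r i := Germ.coe_eq

lemma An.diff (f : An E) : ∀ᶠ x in 𝓝 (0 : E), DifferentiableAt ℝ f.1 x :=
  (show AnalyticAt ℝ f.1 0 from f.2).eventually_analyticAt.mono fun _ h => h.differentiableAt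

/-- The ring morphism to dual numbers given by a vector field. -/
def Psi (a : α → E) (ha : Tendsto a 𝒰 (𝓝 0)) (w : E → E) :
    An E →+* DualNumber (Germ (𝒰 : Filter α) ℝ) where
  toFun f := (ev 𝒰 a f, Dv 𝒰 a w f.1)
  map_one' := by
    refine TrivSqZeroExt.ext (map_one _) ?_
    refine Germ.coe_eq.2 (Eventually.of_forall fun i => ?_)
    change fderiv ℝ (fun _ : E => (1:ℝ)) (a i) (w (a i)) = 0
    simp
  map_zero' := by
    refine TrivSqZeroExt.ext (map_zero _) ?_
    refine Germ.coe_eq.2 (Eventually.of_forall fun i => ?_)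
    change fderiv ℝ (fun _ : E => (0:ℝ)) (a i) (w (a i)) = 0
    simp
  map_add' f g := by
    refine TrivSqZeroExt.ext (map_add _ _ _) ?_
    refine Germ.coe_eq.2 ?_
    filter_upwards [ha.eventually (An.diff f), ha.eventually (An.diff g)] with i hf hg
    change fderiv ℝ (f.1 + g.1) (a i) (w (a i)) = _
    rw [fderiv_add hf hg]; rfl
  map_mul' f g := by
    refine TrivSqZeroExt.ext (map_mul _ _ _) ?_
    refine Eq.trans ?_ (TrivSqZeroExt.snd_mul
      (show DualNumber (Germ (𝒰 : Filter α) ℝ) from (ev 𝒰 a f, Dv 𝒰 a w f.1))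
      (show DualNumber (Germ (𝒰 : Filter α) ℝ) from (ev 𝒰 a g, Dv 𝒰 a w g.1))).symm
    refine Germ.coe_eq.2 ?_
    filter_upwards [ha.eventually (An.diff f), ha.eventually (An.diff g)] with i hf hg
    change fderiv ℝ (f.1 * g.1) (a i) (w (a i)) =
      f.1 (a i) * fderiv ℝ g.1 (a i) (w (a i)) + fderiv ℝ f.1 (a i) (w (a i)) * g.1 (a i)
    rw [fderiv_mul hf hg, mul_comm (fderiv ℝ f.1 (a i) (w (a i)))]; rfl

lemma Psi_fst (a : α → E) (ha : Tendsto a 𝒰 (𝓝 0)) (w : E → E) (f : An E) :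
    (Psi 𝒰 a ha w f).fst = ev 𝒰 a f := rfl
lemma Psi_snd (a : α → E) (ha : Tendsto a 𝒰 (𝓝 0)) (w : E → E) (f : An E) :
    (Psi 𝒰 a ha w f).snd = Dv 𝒰 a w f.1 := rfl

/-- Vector fields tangent to the ideal of functions vanishing along the ultrafilter. -/
def Tan (a : α → E) (w : E → E) : Prop :=
  AnalyticAt ℝ w 0 ∧ ∀ f : An E, ev 𝒰 a f = 0 → Dv 𝒰 a w f.1 = 0

/-- The integration property. -/
def PFor (a : α → E) : Prop :=
  ∀ g h : An E, ev 𝒰 a h ≠ 0 →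
    (∀ w, Tan 𝒰 a w → ev 𝒰 a h * Dv 𝒰 a w g.1 = ev 𝒰 a g * Dv 𝒰 a w h.1) →
    ∃ c : ℝ, ev 𝒰 a g = (fun _ => c : α → ℝ) * ev 𝒰 a h

lemma analyticAt_dir (f : An E) (w : E → E) (hw : AnalyticAt ℝ w 0) [CompleteSpace E] :
    AnalyticAt ℝ (fun x => fderiv ℝ f.1 x (w x)) 0 :=
  analyticAt_clm_apply' (show AnalyticAt ℝ f.1 0 from f.2).fderiv hw

lemma PFor_base [CompleteSpace E] (a : α → E) (ha : Tendsto a 𝒰 (𝓝 0))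
    (hp : ∀ f : An E, ev 𝒰 a f = 0 → ∀ᶠ x in 𝓝 (0 : E), f.1 x = 0) : PFor 𝒰 a := by
  intro g h hh H
  have hconst : ∀ v : E, Tan 𝒰 a (fun _ => v) := by
    intro v
    refine ⟨analyticAt_const, fun f hf => ?_⟩
    have h1 := eventually_eventually_nhds.2 (hp f hf)
    refine (Dv_eq_iff 𝒰 a _ _ (fun _ => 0)).2 ?_
    filter_upwards [ha.eventually h1] with i hi
    have : f.1 =ᶠ[𝓝 (a i)] fun _ => (0:ℝ) := hi
    rw [this.fderiv_eq]; simp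
  obtain ⟨r, hr, hball⟩ := Metric.eventually_nhds_iff_ball.1
    ((show AnalyticAt ℝ g.1 0 from g.2).eventually_analyticAt.and
      (show AnalyticAt ℝ h.1 0 from h.2).eventually_analyticAt)
  have hg : AnalyticOnNhd ℝ g.1 (ball 0 r) := fun x hx => (hball x hx).1
  have hh' : AnalyticOnNhd ℝ h.1 (ball 0 r) := fun x hx => (hball x hx).2
  have hpre : IsPreconnected (ball (0:E) r) := (convex_ball 0 r).isPreconnected
  have h0 : (0:E) ∈ ball (0:E) r := mem_ball_self hr
  have hrel : ∀ v : E, ∀ x ∈ ball (0:E) r, h.1 x * fderiv ℝ g.1 x v = g.1 x * fderiv ℝ h.1 x v := by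
    intro v
    have e1 : AnalyticOnNhd ℝ (fun x => h.1 x * fderiv ℝ g.1 x v) (ball 0 r) := fun x hx =>
      (hh' x hx).mul (analyticAt_clm_apply' (hg x hx).fderiv analyticAt_const)
    have e2 : AnalyticOnNhd ℝ (fun x => g.1 x * fderiv ℝ h.1 x v) (ball 0 r) := fun x hx =>
      (hg x hx).mul (analyticAt_clm_apply' (hh' x hx).fderiv analyticAt_const)
    let f1 : An E := ⟨_, e1 0 h0⟩
    let f2 : An E := ⟨_, e2 0 h0⟩
    have e3 : ev 𝒰 a (f1 - f2) = 0 := by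
      rw [map_sub, sub_eq_zero]; exact H _ (hconst v)
    have e4 := hp _ e3
    exact e1.eqOn_of_preconnected_of_eventuallyEq e2 hpre h0
      (e4.mono fun x hx => sub_eq_zero.1 hx)
  have hne : ∃ x0 ∈ ball (0:E) r, h.1 x0 ≠ 0 := by
    by_contra hcon
    push Not at hcon
    apply hh
    rw [ev_eq_zero_iff]
    filter_upwards [ha.eventually (ball_mem_nhds (0:E) hr)] with i hi using hcon _ hi
  obtain ⟨x0, hx0, hne⟩ := hne
  refine ⟨g.1 x0 / h.1 x0, ?_⟩
  set c := g.1 x0 / h.1 x0 with hc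
  obtain ⟨s, hs, hsball⟩ := Metric.eventually_nhds_iff_ball.1
    (((hh' x0 hx0).continuousAt.eventually_ne hne).and (isOpen_ball.mem_nhds hx0))
  have hder : ∀ y ∈ ball x0 s, HasFDerivAt (fun x => g.1 x / h.1 x)
      (g.1 y • ((-(h.1 y ^ 2)⁻¹) • fderiv ℝ h.1 y) + (h.1 y)⁻¹ • fderiv ℝ g.1 y) y := by
    intro y hy
    have hyg := (hg y (hsball y hy).2).differentiableAt.hasFDerivAt
    have hyh := (hh' y (hsball y hy).2).differentiableAt.hasFDerivAt
    have hinv := (hasDerivAt_inv (hsball y hy).1).comp_hasFDerivAt y hyh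
    have := hyg.mul hinv
    simp only [div_eq_mul_inv]
    exact this
  have hq : ∀ x ∈ ball x0 s, g.1 x / h.1 x = c := by
    intro x hx
    refine (convex_ball x0 s).is_const_of_fderivWithin_eq_zero (𝕜 := ℝ) (f := fun x => g.1 x / h.1 x)
      ?_ ?_ hx (mem_ball_self hs)
    · intro y hy
      exact (hder y hy).differentiableAt.differentiableWithinAt
    · intro y hy
      rw [fderivWithin_of_isOpen isOpen_ball hy]
      ext v
      rw [(hder y hy).fderiv]
      have h2 := hrel v y (hsball y hy).2
      have h3 := (hsball y hy).1
      change g.1 y * (-(h.1 y ^ 2)⁻¹ * fderiv ℝ h.1 y v) + (h.1 y)⁻¹ * fderiv ℝ g.1 y v = 0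
      field_simp
      linarith
  have hfin : EqOn g.1 (fun x => c * h.1 x) (ball 0 r) := by
    refine hg.eqOn_of_preconnected_of_eventuallyEq (fun x hx => analyticAt_const.mul (hh' x hx))
      hpre hx0 ?_
    filter_upwards [ball_mem_nhds x0 hs] with x hx
    rw [← hq x hx, div_mul_cancel₀ _ (hsball x hx).1]
  refine Germ.coe_eq.2 ?_
  filter_upwards [ha.eventually (ball_mem_nhds (0:E) hr)] with i hi using hfin hi

/-- Pull back of analytic functions. -/
def An.comp {E₂ : Type*} [NormedAddCommGroup E₂] [NormedSpace ℝ E₂] (e : E →L[ℝ] E₂) :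
    An E₂ →+* An E where
  toFun f := ⟨fun x => f.1 (e x), AnalyticAt.comp (f := e) (x := (0:E))
    (by rw [map_zero]; exact f.2) (e.analyticAt 0)⟩
  map_one' := rfl
  map_mul' _ _ := rfl
  map_zero' := rfl
  map_add' _ _ := rfl

lemma PFor_transport {E₂ : Type*} [NormedAddCommGroup E₂] [NormedSpace ℝ E₂] (e : E ≃L[ℝ] E₂)
    (a : α → E) (h : PFor 𝒰 (fun i => e (a i))) : PFor 𝒰 a := by
  have hfd : ∀ (f : E → ℝ) (x v), fderiv ℝ (fun y : E₂ => f (e.symm y)) (e x) (e v)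
      = fderiv ℝ f x v := by
    intro f x v
    have := e.symm.comp_right_fderiv (f := f) (x := e x)
    change fderiv ℝ (f ∘ e.symm) (e x) (e v) = _
    rw [this]; simp
  intro g h' hh H
  refine h (An.comp (e.symm : E₂ →L[ℝ] E) g) (An.comp (e.symm : E₂ →L[ℝ] E) h') ?_ ?_ |>.imp ?_
  · intro h0
    apply hh
    rw [ev_eq_zero_iff] at h0 ⊢
    filter_upwards [h0] with i hi
    simpa [An.comp] using hi
  · rintro w ⟨hw1, hw2⟩
    have ht : Tan 𝒰 a (fun x => e.symm (w (e x))) := by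
      constructor
      · have e1 : AnalyticAt ℝ (fun x => w (e x)) 0 := AnalyticAt.comp (f := e) (x := (0:E))
          (by rw [map_zero]; exact hw1) ((e : E →L[ℝ] E₂).analyticAt 0)
        exact AnalyticAt.comp (f := fun x => w (e x)) (x := (0:E))
          ((e.symm : E₂ →L[ℝ] E).analyticAt _) e1
      · intro f hf
        have := hw2 (An.comp (e.symm : E₂ →L[ℝ] E) f) (by
          rw [ev_eq_zero_iff] at hf ⊢
          filter_upwards [hf] with i hi
          simpa [An.comp] using hi)
        refine (Dv_eq_iff 𝒰 a _ _ (fun _ => 0)).2 ?_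
        filter_upwards [(Dv_eq_iff 𝒰 _ _ _ (fun _ => 0)).1 this] with i hi
        rw [← hfd, e.apply_symm_apply]
        exact hi
    have := H _ ht
    have h1 := Germ.coe_eq.1 this
    refine Germ.coe_eq.2 ?_
    filter_upwards [h1] with i hi
    replace hi : h'.1 (a i) * fderiv ℝ g.1 (a i) (e.symm (w (e (a i)))) =
      g.1 (a i) * fderiv ℝ h'.1 (a i) (e.symm (w (e (a i)))) := hi
    rw [← hfd, e.apply_symm_apply, ← hfd, e.apply_symm_apply] at hi
    simpa [An.comp] using hi
  · intro c hc
    refine Germ.coe_eq.2 ?_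
    filter_upwards [Germ.coe_eq.1 hc] with i hi
    simpa [An.comp] using hi
end germs

section step
open Filter Polynomial
variable {α : Type} (𝒰 : Ultrafilter α) {n : ℕ}

/-- inclusion of functions of the first variables -/
def iota (n : ℕ) : An (Fin n → ℝ) →+* An ((Fin n → ℝ) × ℝ) :=
  An.comp (ContinuousLinearMap.fst ℝ (Fin n → ℝ) ℝ)

/-- last coordinate -/
def tau (n : ℕ) : An ((Fin n → ℝ) × ℝ) := ⟨fun z => z.2, analyticAt_snd⟩

/-- polynomial functions in the last coordinate -/
def pol (n : ℕ) : (An (Fin n → ℝ))[X] →+* An ((Fin n → ℝ) × ℝ) :=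
  Polynomial.eval₂RingHom (iota n) (tau n)

/-- point evaluation -/
def pev {E : Type*} [NormedAddCommGroup E] [NormedSpace ℝ E] (z : E) : An E →+* ℝ :=
  (Pi.evalRingHom (fun _ => ℝ) z).comp (An E).subtype

lemma pev_apply {E : Type*} [NormedAddCommGroup E] [NormedSpace ℝ E] (z : E) (f : An E) :
  pev z f = f.1 z := rfl

lemma pol_sum_apply (d : ℕ) (R : ℕ → An (Fin n → ℝ)) (z : (Fin n → ℝ) × ℝ) :
    (pol n (∑ i ∈ Finset.range d, C (R i) * X ^ i)).1 z
      = ∑ i ∈ Finset.range d, (R i).1 z.1 * z.2 ^ i := by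
  rw [← pev_apply, map_sum, map_sum]
  refine Finset.sum_congr rfl fun i _ => ?_
  rw [map_mul, map_mul, map_pow, map_pow]
  simp only [pol, coe_eval₂RingHom, eval₂_C, eval₂_X]
  rfl

lemma wdiv (f : An ((Fin n → ℝ) × ℝ)) (hreg : ¬ ∀ᶠ t in 𝓝 (0:ℝ), f.1 (0, t) = 0) :
    ∃ W : (An (Fin n → ℝ))[X], W.Monic ∧
      (∃ Q : An ((Fin n → ℝ) × ℝ), ∀ᶠ z in 𝓝 0, (pol n W).1 z = (Q * f).1 z) ∧
      ∀ g : An ((Fin n → ℝ) × ℝ), ∃ (Q : An ((Fin n → ℝ) × ℝ)) (R : (An (Fin n → ℝ))[X]),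
        ∀ᶠ z in 𝓝 0, g.1 z = (Q * pol n W + pol n R).1 z := by
  obtain ⟨d, hd⟩ := weierstrass_division f.1 f.2 hreg
  obtain ⟨Q, hQ, R, hR, hQR⟩ := hd (tau n ^ d).1 (tau n ^ d).2
  set R' : (An (Fin n → ℝ))[X] := ∑ i ∈ Finset.range d, C (⟨R i, hR i⟩ : An _) * X ^ i with hR'
  have hdeg : R'.degree < d := by
    rw [hR', Polynomial.degree_lt_iff_coeff_zero]
    intro m hm
    rw [finsetSum_coeff]
    refine Finset.sum_eq_zero fun i hi => ?_
    rw [coeff_C_mul, coeff_X_pow, if_neg, mul_zero]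
    have := Finset.mem_range.1 hi
    omega
  have hmon : (X ^ d - R').Monic := by
    rw [sub_eq_add_neg]
    apply monic_X_pow_add
    rwa [degree_neg]
  have hval : ∀ z, (pol n (X ^ d - R')).1 z
      = z.2 ^ d - ∑ i ∈ Finset.range d, R i z.1 * z.2 ^ i := by
    intro z
    rw [map_sub, map_pow]
    change (pol n X).1 z ^ d - (pol n R').1 z = _
    rw [hR', pol_sum_apply]
    simp [pol, tau]
  refine ⟨X ^ d - R', hmon, ⟨⟨Q, hQ⟩, ?_⟩, ?_⟩
  · filter_upwards [hQR] with z hz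
    rw [hval]
    have : (tau n ^ d).1 z = z.2 ^ d := rfl
    rw [this] at hz
    rw [hz]
    change _ = Q z * f.1 z
    ring
  · have hreg2 : ¬ ∀ᶠ t in 𝓝 (0:ℝ), (pol n (X ^ d - R')).1 (0, t) = 0 := by
      intro hcon
      have hne : (X ^ d - R').map (pev (0 : Fin n → ℝ)) ≠ 0 := (hmon.map _).ne_zero
      apply hne
      apply Polynomial.eq_zero_of_infinite_isRoot
      refine (infinite_of_mem_nhds (0:ℝ) hcon).mono ?_
      intro t ht
      have ht : (pol n (X ^ d - R')).1 (0, t) = 0 := ht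
      change Polynomial.eval t _ = 0
      rw [hval] at ht
      rw [← ht, Polynomial.map_sub, hR', Polynomial.map_sum]
      simp only [Polynomial.map_pow, Polynomial.map_mul, map_X, map_C, eval_sub, eval_pow, eval_X,
        eval_finsetSum, eval_mul, eval_C]
      rfl
    obtain ⟨d2, hd2⟩ := weierstrass_division _ (pol n (X ^ d - R')).2 hreg2
    intro g
    obtain ⟨Q2, hQ2, R2, hR2, h2⟩ := hd2 g.1 g.2
    refine ⟨⟨Q2, hQ2⟩, ∑ i ∈ Finset.range d2, C (⟨R2 i, hR2 i⟩ : An _) * X ^ i, ?_⟩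
    filter_upwards [h2] with z hz
    rw [hz]
    change _ = Q2 z * (pol n (X ^ d - R')).1 z + (pol n _).1 z
    rw [pol_sum_apply]

lemma exists_alg {O L : Type*} [CommRing O] [Field L] (φ : O →+* L) (b : L) (W : O[X])
    (hW : W.Monic) (hWb : W.eval₂ φ b = 0) (P Q : O[X]) :
    ∃ R : O[X], R.map φ ≠ 0 ∧ R.eval₂ φ (P.eval₂ φ b / Q.eval₂ φ b) = 0 := by
  have hcomp : ∀ S : O[X], (S.map φ.rangeRestrict).map φ.range.subtype = S.map φ := by
    intro S; rw [Polynomial.map_map]; rfl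
  have hb : IsIntegral φ.range b := by
    refine ⟨W.map φ.rangeRestrict, hW.map _, ?_⟩
    change eval₂ φ.range.subtype b _ = 0
    rw [eval₂_eq_eval_map, hcomp, ← eval₂_eq_eval_map, hWb]
  have hintg : ∀ S : O[X], IsAlgebraic φ.range (S.eval₂ φ b) := by
    intro S
    apply IsIntegral.isAlgebraic
    rw [eval₂_eq_sum_range]
    apply IsIntegral.sum
    intro i _
    refine IsIntegral.mul ?_ (hb.pow i)
    exact isIntegral_algebraMap (R := φ.range) (x := φ.rangeRestrict (S.coeff i))
  obtain ⟨p, hp, hp0⟩ : IsAlgebraic φ.range (P.eval₂ φ b / Q.eval₂ φ b) := by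
    rw [div_eq_mul_inv]
    exact (hintg P).mul (hintg Q).inv
  obtain ⟨R, rfl⟩ := Polynomial.map_surjective _ φ.rangeRestrict_surjective p
  refine ⟨R, ?_, ?_⟩
  · rw [← hcomp]
    intro h0
    exact hp ((Polynomial.map_eq_zero_iff Subtype.val_injective).1 h0)
  · change eval₂ φ.range.subtype _ _ = 0 at hp0
    rw [eval₂_eq_eval_map, hcomp, ← eval₂_eq_eval_map] at hp0
    exact hp0
end step

section step2
open Filter Polynomial
variable {α : Type} (𝒰 : Ultrafilter α) {n : ℕ}

lemma Psi_congr {E : Type*} [NormedAddCommGroup E] [NormedSpace ℝ E] (a : α → E)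
    (ha : Tendsto a 𝒰 (𝓝 0)) (w : E → E) (f g : An E) (h : ∀ᶠ z in 𝓝 0, f.1 z = g.1 z) :
    Psi 𝒰 a ha w f = Psi 𝒰 a ha w g := by
  refine TrivSqZeroExt.ext ?_ ?_
  · exact Germ.coe_eq.2 (ha.eventually h)
  · refine Germ.coe_eq.2 ?_
    filter_upwards [ha.eventually (eventually_eventually_nhds.2 h)] with i hi
    have : f.1 =ᶠ[𝓝 (a i)] g.1 := hi
    rw [this.fderiv_eq]

lemma ev_congr {E : Type*} [NormedAddCommGroup E] [NormedSpace ℝ E] (a : α → E)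
    (ha : Tendsto a 𝒰 (𝓝 0)) (f g : An E) (h : ∀ᶠ z in 𝓝 0, f.1 z = g.1 z) :
    ev 𝒰 a f = ev 𝒰 a g := Germ.coe_eq.2 (ha.eventually h)

lemma ev_pol (a : α → (Fin n → ℝ) × ℝ) (P : (An (Fin n → ℝ))[X]) :
    ev 𝒰 a (pol n P) = P.eval₂ (ev 𝒰 (fun i => (a i).1)) (ev 𝒰 a (tau n)) :=
  Polynomial.hom_eval₂ P (iota n) (ev 𝒰 a) (tau n)

/-- lifting a tangent field -/
lemma lift_field (a : α → (Fin n → ℝ) × ℝ) (ha : Tendsto a 𝒰 (𝓝 0))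
    (W0 : (An (Fin n → ℝ))[X]) (hW0m : W0.Monic) (hW0 : ev 𝒰 a (pol n W0) = 0)
    (hdiv : ∀ g : An ((Fin n → ℝ) × ℝ), ∃ (Q : An ((Fin n → ℝ) × ℝ)) (R : (An (Fin n → ℝ))[X]),
        ∀ᶠ z in 𝓝 0, g.1 z = (Q * pol n W0 + pol n R).1 z)
    (w' : (Fin n → ℝ) → (Fin n → ℝ)) (hw' : Tan 𝒰 (fun i => (a i).1) w') :
    ∃ w, Tan 𝒰 a w ∧ ∃ u : Germ (𝒰 : Filter α) ℝ, u ≠ 0 ∧ ∀ c : An (Fin n → ℝ),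
      Dv 𝒰 a w (iota n c).1 = u * Dv 𝒰 (fun i => (a i).1) w' c.1 := by
  set φ := ev 𝒰 (fun i => (a i).1) with hφ
  set b := ev 𝒰 a (tau n) with hb
  have ha1 : Tendsto (fun i => (a i).1) 𝒰 (𝓝 0) := (continuous_fst.tendsto 0).comp ha
  rw [ev_pol] at hW0
  obtain ⟨W, hW, hl, hd, hmin⟩ := exists_minpol φ b ⟨W0, (hW0m.map φ).ne_zero, hW0⟩
  have hder := minpol_deriv_ne φ b W hl hd hmin
  let dc : ℕ → An (Fin n → ℝ) := fun k => ⟨_, analyticAt_dir (W.coeff k) w' hw'.1⟩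
  let Δ : An ((Fin n → ℝ) × ℝ) :=
    pol n (∑ k ∈ Finset.range (W.natDegree + 1), C (dc k) * X ^ k)
  let Ud : An ((Fin n → ℝ) × ℝ) := pol n W.derivative
  let w : (Fin n → ℝ) × ℝ → (Fin n → ℝ) × ℝ := fun z => (Ud.1 z • w' z.1, -Δ.1 z)
  have hwan : AnalyticAt ℝ w 0 := by
    have e1 : AnalyticAt ℝ (fun z : (Fin n → ℝ) × ℝ => w' z.1) 0 :=
      AnalyticAt.comp (f := fun z : (Fin n → ℝ) × ℝ => z.1) (x := 0) hw'.1 analyticAt_fst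
    have e2 : AnalyticAt ℝ Ud.1 0 := Ud.2
    have e3 : AnalyticAt ℝ Δ.1 0 := Δ.2
    exact (e2.smul e1).prod e3.neg
  have hUd : ev 𝒰 a Ud = W.derivative.eval₂ φ b := ev_pol 𝒰 a _
  have hDc : ∀ c : An (Fin n → ℝ),
      Dv 𝒰 a w (iota n c).1 = ev 𝒰 a Ud * Dv 𝒰 (fun i => (a i).1) w' c.1 := by
    intro c
    refine Germ.coe_eq.2 ?_
    filter_upwards [ha1.eventually (An.diff c)] with i hi
    change fderiv ℝ (fun z : (Fin n → ℝ) × ℝ => c.1 z.1) (a i) (w (a i))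
      = Ud.1 (a i) * fderiv ℝ c.1 (a i).1 (w' (a i).1)
    have h1 : HasFDerivAt (fun z : (Fin n → ℝ) × ℝ => c.1 z.1) _ (a i) :=
      HasFDerivAt.comp (a i) (f := Prod.fst) hi.hasFDerivAt hasFDerivAt_fst
    rw [h1.fderiv]
    change fderiv ℝ c.1 (a i).1 (Ud.1 (a i) • w' (a i).1) = _
    rw [map_smul]; rfl
  set Ψ := Psi 𝒰 a ha w with hΨ
  set ψ := Ψ.comp (iota n) with hψ
  set β := Ψ (tau n) with hβ
  have hψf : ∀ c, (ψ c).fst = φ c := fun c => rfl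
  have hψs : ∀ c, (ψ c).snd = ev 𝒰 a Ud * Dv 𝒰 (fun i => (a i).1) w' c.1 := hDc
  have hβf : β.fst = b := rfl
  have hβs : β.snd = - ev 𝒰 a Δ := by
    refine Germ.coe_eq.2 (Eventually.of_forall fun i => ?_)
    change fderiv ℝ (fun z : (Fin n → ℝ) × ℝ => z.2) (a i) (w (a i)) = - Δ.1 (a i)
    rw [show (fun z : (Fin n → ℝ) × ℝ => z.2) = Prod.snd from rfl, fderiv_snd]
    rfl
  have hΔ : ev 𝒰 a Δ = ∑ k ∈ Finset.range (W.natDegree + 1),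
      Dv 𝒰 (fun i => (a i).1) w' (W.coeff k).1 * b ^ k := by
    change ev 𝒰 a (pol n _) = _
    rw [ev_pol, eval₂_finsetSum]
    refine Finset.sum_congr rfl fun k _ => ?_
    rw [eval₂_mul, eval₂_C, eval₂_pow, eval₂_X]
    rfl
  have hWβ : W.eval₂ ψ β = 0 := by
    have := snd_eval₂ ψ φ hψf β W
    refine TrivSqZeroExt.ext ?_ ?_
    · rw [this.1, hβf, hW]; rfl
    · rw [this.2, hβf, hβs, hΔ, ← hUd]
      simp only [hψs]
      rw [TrivSqZeroExt.snd_zero, neg_mul, Finset.sum_mul, ← sub_eq_add_neg, sub_eq_zero]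
      refine Finset.sum_congr rfl fun k _ => ?_
      ring
  have hlift := minpol_lift φ b W hl hd hW hmin ψ β (by
      intro c hc
      refine TrivSqZeroExt.ext ?_ ?_
      · rw [hψf, hc]; rfl
      · rw [hψs, hw'.2 c hc, mul_zero]; rfl)
    (by
      intro c hc
      rw [TrivSqZeroExt.isUnit_iff_isUnit_fst, hψf]
      exact IsUnit.mk0 _ hc) hWβ
  have hpolΨ : ∀ R : (An (Fin n → ℝ))[X], ev 𝒰 a (pol n R) = 0 → Ψ (pol n R) = 0 := by
    intro R hR
    rw [ev_pol] at hR
    have := hlift R hR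
    rw [← this]
    exact Polynomial.hom_eval₂ R (iota n) Ψ (tau n)
  refine ⟨w, ⟨hwan, fun q hq => ?_⟩, ev 𝒰 a Ud, by rw [hUd]; exact hder, hDc⟩
  obtain ⟨Q, R, hQR⟩ := hdiv q
  have hW0' : ev 𝒰 a (pol n W0) = 0 := by rw [ev_pol]; exact hW0
  have e1 : ev 𝒰 a (pol n R) = 0 := by
    have := ev_congr 𝒰 a ha q (Q * pol n W0 + pol n R) hQR
    rw [hq, map_add, map_mul, hW0', mul_zero, zero_add] at this
    exact this.symm
  have e2 : Ψ q = 0 := by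
    rw [hΨ, Psi_congr 𝒰 a ha w q (Q * pol n W0 + pol n R) hQR, ← hΨ, map_add, map_mul,
      hpolΨ _ hW0', hpolΨ _ e1, mul_zero, zero_add]
  exact congrArg TrivSqZeroExt.snd e2
end step2

section step3
open Filter Polynomial
variable {α : Type} (𝒰 : Ultrafilter α) {n : ℕ}

lemma germ_const_of_root (t : α → ℝ) (r : ℝ[X]) (hr : r ≠ 0)
    (h : ∀ᶠ i in (𝒰 : Filter α), r.eval (t i) = 0) :
    ∃ c : ℝ, ∀ᶠ i in (𝒰 : Filter α), t i = c := by
  have h1 : ∀ᶠ i in (𝒰 : Filter α), ∃ c ∈ (r.roots.toFinset : Set ℝ), t i = c := by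
    filter_upwards [h] with i hi
    refine ⟨t i, ?_, rfl⟩
    simp [hr, hi]
  obtain ⟨c, _, hc⟩ := (Ultrafilter.eventually_exists_mem_iff (Finset.finite_toSet _)).1 h1
  exact ⟨c, hc⟩

lemma PFor_step (a : α → (Fin n → ℝ) × ℝ) (ha : Tendsto a 𝒰 (𝓝 0))
    (f : An ((Fin n → ℝ) × ℝ)) (hf : ev 𝒰 a f = 0)
    (hreg : ¬ ∀ᶠ t in 𝓝 (0:ℝ), f.1 (0, t) = 0)
    (IH : PFor 𝒰 (fun i => (a i).1)) : PFor 𝒰 a := by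
  obtain ⟨W0, hW0m, ⟨Q0, hQ0⟩, hdiv⟩ := wdiv f hreg
  have hW0 : ev 𝒰 a (pol n W0) = 0 := by
    rw [ev_congr 𝒰 a ha _ _ hQ0, map_mul, hf, mul_zero]
  intro g h hh H
  set φ := ev 𝒰 (fun i => (a i).1) with hφ
  set b := ev 𝒰 a (tau n) with hb
  have hrep : ∀ q : An ((Fin n → ℝ) × ℝ), ∃ R : (An (Fin n → ℝ))[X],
      ev 𝒰 a q = R.eval₂ φ b := by
    intro q
    obtain ⟨Q, R, hQR⟩ := hdiv q
    refine ⟨R, ?_⟩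
    rw [ev_congr 𝒰 a ha _ _ hQR, map_add, map_mul, hW0, mul_zero, zero_add, ev_pol]
  set θ := ev 𝒰 a g / ev 𝒰 a h with hθ
  have hgθ : ev 𝒰 a g = θ * ev 𝒰 a h := by rw [hθ, div_mul_cancel₀ _ hh]
  obtain ⟨Rg, hRg⟩ := hrep g
  obtain ⟨Rh, hRh⟩ := hrep h
  have halg := exists_alg φ b W0 hW0m (by rw [← ev_pol]; exact hW0) Rg Rh
  rw [← hRg, ← hRh] at halg
  obtain ⟨P, hP, hl, hd, hmin⟩ := exists_minpol φ θ halg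
  set m := P.natDegree with hm
  have key : ∀ k, k < m → ∀ w', Tan 𝒰 (fun i => (a i).1) w' →
      φ P.leadingCoeff * Dv 𝒰 (fun i => (a i).1) w' (P.coeff k).1
        = φ (P.coeff k) * Dv 𝒰 (fun i => (a i).1) w' P.leadingCoeff.1 := by
    intro k hk w' hw'
    obtain ⟨w, hw, u, hu, hDc⟩ := lift_field 𝒰 a ha W0 hW0m hW0 hdiv w' hw'
    set Ψ := Psi 𝒰 a ha w with hΨ
    set ψ := Ψ.comp (iota n) with hψ
    have hψf : ∀ c, (ψ c).fst = φ c := fun c => rfl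
    have hψs : ∀ c, (ψ c).snd = u * Dv 𝒰 (fun i => (a i).1) w' c.1 := hDc
    have hgh : Ψ g = TrivSqZeroExt.inl θ * Ψ h := by
      refine TrivSqZeroExt.ext ?_ ?_
      · rw [TrivSqZeroExt.fst_mul]; exact hgθ
      · rw [TrivSqZeroExt.snd_mul]
        change Dv 𝒰 a w g.1 = θ * Dv 𝒰 a w h.1 + 0 * ev 𝒰 a h
        have := H w hw
        rw [hgθ] at this
        apply mul_left_cancel₀ hh
        rw [this]; ring
    let Qf : An ((Fin n → ℝ) × ℝ) :=
      ∑ k ∈ Finset.range (m + 1), iota n (P.coeff k) * g ^ k * h ^ (m - k)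
    have hQf : Ψ Qf = Ψ h ^ m * P.eval₂ ψ (TrivSqZeroExt.inl θ) := by
      rw [map_sum, eval₂_eq_sum_range, Finset.mul_sum]
      refine Finset.sum_congr rfl fun k hk => ?_
      have hk' : k ≤ m := by have := Finset.mem_range.1 hk; omega
      rw [map_mul, map_mul, map_pow, map_pow, hgh, mul_pow]
      have e : Ψ h ^ m = Ψ h ^ k * Ψ h ^ (m - k) := by
        rw [← pow_add, Nat.add_sub_cancel' hk']
      rw [e]
      change ψ (P.coeff k) * _ * _ = _
      ring
    have hs := snd_eval₂ ψ φ hψf (TrivSqZeroExt.inl θ) P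
    have hQ0 : ev 𝒰 a Qf = 0 := by
      have := congrArg TrivSqZeroExt.fst hQf
      rw [TrivSqZeroExt.fst_mul, hs.1, TrivSqZeroExt.fst_inl, hP, mul_zero] at this
      exact this
    have hΨQ : Ψ Qf = 0 := by
      refine TrivSqZeroExt.ext ?_ ?_
      · exact hQ0
      · exact hw.2 Qf hQ0
    have hunit : IsUnit (Ψ h ^ m) := by
      apply IsUnit.pow
      rw [TrivSqZeroExt.isUnit_iff_isUnit_fst]
      exact IsUnit.mk0 _ hh
    rw [hΨQ] at hQf
    have h0 : P.eval₂ ψ (TrivSqZeroExt.inl θ) = 0 := hunit.mul_right_eq_zero.1 hQf.symm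
    have h1 := hs.2
    rw [h0] at h1
    simp only [hψs, TrivSqZeroExt.snd_zero, TrivSqZeroExt.fst_inl, TrivSqZeroExt.snd_inl,
      zero_mul, add_zero, mul_assoc] at h1
    rw [← Finset.mul_sum] at h1
    have h2 : ∑ k ∈ Finset.range (m + 1),
        Dv 𝒰 (fun i => (a i).1) w' (P.coeff k).1 * θ ^ k = 0 :=
      (mul_eq_zero.1 h1.symm).resolve_left hu
    -- eliminate the leading coefficient
    let dc : ℕ → An (Fin n → ℝ) := fun k => ⟨_, analyticAt_dir (P.coeff k) w' hw'.1⟩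
    have hdc : ∀ k, φ (dc k) = Dv 𝒰 (fun i => (a i).1) w' (P.coeff k).1 := fun k => rfl
    let e : ℕ → An (Fin n → ℝ) := fun k => P.coeff m * dc k - dc m * P.coeff k
    let S : (An (Fin n → ℝ))[X] := ∑ k ∈ Finset.range m, C (e k) * X ^ k
    have hSd : S.natDegree < m := by
      have : S.natDegree ≤ m - 1 := by
        refine natDegree_sum_le_of_forall_le _ _ fun k hk => ?_
        refine (natDegree_C_mul_X_pow_le _ _).trans ?_
        have := Finset.mem_range.1 hk
        omega
      omega
    have hSθ : S.eval₂ φ θ = 0 := by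
      have e1 : S.eval₂ φ θ = ∑ k ∈ Finset.range (m + 1), φ (e k) * θ ^ k := by
        rw [eval₂_finsetSum, Finset.sum_range_succ]
        have : φ (e m) = 0 := by
          have : e m = 0 := by change P.coeff m * dc m - dc m * P.coeff m = 0; ring
          rw [this, map_zero]
        rw [this, zero_mul, add_zero]
        refine Finset.sum_congr rfl fun k _ => ?_
        rw [eval₂_mul, eval₂_C, eval₂_pow, eval₂_X]
      have e2 : ∀ k, φ (e k) * θ ^ k
          = φ (P.coeff m) * (Dv 𝒰 (fun i => (a i).1) w' (P.coeff k).1 * θ ^ k)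
            - φ (dc m) * (φ (P.coeff k) * θ ^ k) := by
        intro k
        change φ (P.coeff m * dc k - dc m * P.coeff k) * θ ^ k = _
        rw [map_sub, map_mul, map_mul, ← hdc]; ring
      rw [e1]
      simp only [e2]
      rw [Finset.sum_sub_distrib, ← Finset.mul_sum, ← Finset.mul_sum, h2, mul_zero,
        ← eval₂_eq_sum_range, hP, mul_zero, sub_zero]
    have h3 := hmin S hSθ hSd
    have h4 := congrArg (fun p => coeff p k) h3
    have h5 : S.coeff k = e k := by
      change (∑ k ∈ Finset.range m, C (e k) * X ^ k).coeff k = _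
      rw [finsetSum_coeff]
      simp only [coeff_C_mul, coeff_X_pow, mul_ite, mul_one, mul_zero]
      rw [Finset.sum_ite_eq, if_pos (Finset.mem_range.2 hk)]
    simp only [coeff_map, coeff_zero, h5] at h4
    have h6 : φ (P.coeff m * dc k - dc m * P.coeff k) = 0 := h4
    rw [map_sub, map_mul, map_mul, hdc, hdc, sub_eq_zero] at h6
    rw [mul_comm (φ (P.coeff k))]
    exact h6
  have hr : ∀ k, ∃ r : ℝ, k < m → φ (P.coeff k) = (fun _ => r : α → ℝ) * φ P.leadingCoeff := by
    intro k
    by_cases hk : k < m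
    · obtain ⟨r, hr⟩ := IH (P.coeff k) P.leadingCoeff hl (key k hk)
      exact ⟨r, fun _ => hr⟩
    · exact ⟨0, fun h => absurd h hk⟩
  choose r hr using hr
  let ρ : ℝ[X] := X ^ m + ∑ k ∈ Finset.range m, C (r k) * X ^ k
  have hρ : ρ.Monic := by
    apply monic_X_pow_add
    rw [Polynomial.degree_lt_iff_coeff_zero]
    intro j hj
    rw [finsetSum_coeff]
    refine Finset.sum_eq_zero fun i hi => ?_
    rw [coeff_C_mul, coeff_X_pow, if_neg, mul_zero]
    have := Finset.mem_range.1 hi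
    omega
  let t : α → ℝ := fun i => g.1 (a i) / h.1 (a i)
  have hroot : ∀ᶠ i in (𝒰 : Filter α), ρ.eval (t i) = 0 := by
    have e1 : ((fun i => ∑ k ∈ Finset.range (m + 1), (P.coeff k).1 (a i).1 * t i ^ k : α → ℝ) :
        Germ (𝒰 : Filter α) ℝ) = 0 := by
      rw [← hP, eval₂_eq_sum_range]
      have := map_sum (Germ.coeRingHom (R := ℝ) (𝒰 : Filter α))
        (fun k => (fun i => (P.coeff k).1 (a i).1 * t i ^ k : α → ℝ)) (Finset.range (m + 1))
      refine Eq.trans ?_ (this.trans ?_)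
      · change Germ.coeRingHom (R := ℝ) (𝒰 : Filter α) _ = _
        congr 1
        ext i
        rw [Finset.sum_apply]
      · rfl
    have e2 := Germ.coe_eq.1 e1
    have e3 : ∀ᶠ i in (𝒰 : Filter α), ∀ k ∈ Finset.range m,
        (P.coeff k).1 (a i).1 = r k * P.leadingCoeff.1 (a i).1 := by
      rw [Filter.eventually_all_finset]
      intro k hk
      exact Germ.coe_eq.1 (hr k (Finset.mem_range.1 hk))
    have e4 : ∀ᶠ i in (𝒰 : Filter α), P.leadingCoeff.1 (a i).1 ≠ 0 := by
      rw [Ultrafilter.eventually_not]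
      intro h0
      exact hl ((ev_eq_zero_iff 𝒰 _ _).2 h0)
    filter_upwards [e2, e3, e4] with i h2 h3 h4
    have h2 : ∑ k ∈ Finset.range (m + 1), (P.coeff k).1 (a i).1 * t i ^ k = 0 := h2
    rw [Finset.sum_range_succ] at h2
    apply (mul_eq_zero.1 (?_ : P.leadingCoeff.1 (a i).1 * ρ.eval (t i) = 0)).resolve_left h4
    rw [← h2]
    simp only [ρ, eval_add, eval_pow, eval_X, eval_finsetSum, eval_mul, eval_C]
    rw [mul_add, add_comm, Finset.mul_sum]
    congr 1
    refine Finset.sum_congr rfl fun k hk => ?_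
    rw [h3 k hk]; ring
  obtain ⟨c, hc⟩ := germ_const_of_root 𝒰 t ρ hρ.ne_zero hroot
  refine ⟨c, ?_⟩
  rw [hgθ]
  congr 1
  exact Germ.coe_eq.2 hc
end step3

section induction_dim
open Filter
variable {α : Type} (𝒰 : Ultrafilter α)

lemma exists_direction {E : Type*} [NormedAddCommGroup E] [NormedSpace ℝ E] (f : An E)
    (hne : ¬ ∀ᶠ x in 𝓝 (0 : E), f.1 x = 0) :
    ∃ v : E, ¬ ∀ᶠ t in 𝓝 (0:ℝ), f.1 (t • v) = 0 := by
  by_contra hcon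
  push Not at hcon
  apply hne
  obtain ⟨r, hr, hball⟩ := Metric.eventually_nhds_iff_ball.1
    (show AnalyticAt ℝ f.1 0 from f.2).eventually_analyticAt
  filter_upwards [ball_mem_nhds (0:E) hr] with x hx
  let S : Set ℝ := (fun t : ℝ => t • x) ⁻¹' ball 0 r
  have hS : IsPreconnected S := by
    apply Convex.isPreconnected
    exact (convex_ball (0:E) r).is_linear_preimage (IsLinearMap.isLinearMap_smul' x)
  have han : AnalyticOnNhd ℝ (fun t : ℝ => f.1 (t • x)) S := by
    intro t ht
    have e1 : AnalyticAt ℝ (fun t : ℝ => t • x) t := analyticAt_id.smul analyticAt_const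
    exact AnalyticAt.comp (f := fun t : ℝ => t • x) (x := t) (hball _ ht) e1
  have h0 : (0:ℝ) ∈ S := by simp [S, hr]
  have h1 : (1:ℝ) ∈ S := by
    change (1:ℝ) • x ∈ ball 0 r
    rwa [one_smul]
  have := han.eqOn_zero_of_preconnected_of_eventuallyEq_zero hS h0 (hcon x) h1
  simpa using this

theorem PFor_all (n : ℕ) (a : α → (Fin n → ℝ)) (ha : Tendsto a 𝒰 (𝓝 0)) : PFor 𝒰 a := by
  induction n with
  | zero =>
    apply PFor_base 𝒰 a ha
    intro f hf
    obtain ⟨i, hi⟩ := ((ev_eq_zero_iff 𝒰 a f).1 hf).exists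
    refine Eventually.of_forall fun x => ?_
    rw [Subsingleton.elim x (a i)]; exact hi
  | succ n ih =>
    by_cases hp : ∀ f : An (Fin (n+1) → ℝ), ev 𝒰 a f = 0 → ∀ᶠ x in 𝓝 0, f.1 x = 0
    · exact PFor_base 𝒰 a ha hp
    push Not at hp
    obtain ⟨f, hf, hne⟩ := hp
    obtain ⟨v, hv⟩ := exists_direction f (by simpa using hne)
    have hf0 : f.1 0 = 0 := by
      have h1 : Tendsto (fun i => f.1 (a i)) 𝒰 (𝓝 (f.1 0)) :=
        (show AnalyticAt ℝ f.1 0 from f.2).continuousAt.tendsto.comp ha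
      have h2 : Tendsto (fun i => f.1 (a i)) 𝒰 (𝓝 0) :=
        tendsto_const_nhds.congr' (((ev_eq_zero_iff 𝒰 a f).1 hf).mono fun i hi => hi.symm)
      exact tendsto_nhds_unique h1 h2
    have hv0 : v ≠ 0 := by
      rintro rfl
      apply hv
      simp [hf0]
    let e0 : (Fin (n+1) → ℝ) ≃L[ℝ] (Fin n → ℝ) × ℝ :=
      ContinuousLinearEquiv.ofFinrankEq (by simp)
    obtain ⟨A, hA⟩ := SeparatingDual.exists_continuousLinearEquiv_apply_eq (R := ℝ)
      (x := e0 v) (y := ((0 : Fin n → ℝ), (1:ℝ))) (by simpa using hv0) (by simp)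
    let e := e0.trans A
    have he : e v = (0, 1) := hA
    have hes : ∀ t : ℝ, e.symm (0, t) = t • v := by
      intro t
      rw [ContinuousLinearEquiv.symm_apply_eq, map_smul, he]
      simp
    apply PFor_transport 𝒰 e a
    have hea : Tendsto (fun i => e (a i)) 𝒰 (𝓝 0) := by
      have := e.continuous.tendsto 0
      rw [map_zero] at this
      exact this.comp ha
    refine PFor_step 𝒰 _ hea (An.comp (e.symm : _ →L[ℝ] _) f) ?_ ?_ ?_
    · rw [ev_eq_zero_iff] at hf ⊢
      filter_upwards [hf] with i hi
      simpa [An.comp] using hi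
    · intro h0
      apply hv
      filter_upwards [h0] with t ht
      rw [← hes]; exact ht
    · exact ih _ ((continuous_fst.tendsto 0).comp hea)

theorem key_lemma {m n : ℕ} (F : EuclideanSpace ℝ (Fin m) → EuclideanSpace ℝ (Fin n))
    (hF : AnalyticAt ℝ F 0) :
    ∃ ε > 0, ∀ x ∈ ball (0 : EuclideanSpace ℝ (Fin m)) ε, F x = 0 →
      (∀ v, fderiv ℝ F x v = 0 → inner ℝ x v = 0) → x = 0 := by
  by_contra hcon
  push Not at hcon
  let S : Set (EuclideanSpace ℝ (Fin m)) :=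
    {x | F x = 0 ∧ (∀ v, fderiv ℝ F x v = 0 → inner ℝ x v = 0) ∧ x ≠ 0}
  have hne : (𝓝[S] (0 : EuclideanSpace ℝ (Fin m))).NeBot := by
    rw [← mem_closure_iff_nhdsWithin_neBot, Metric.mem_closure_iff]
    intro ε hε
    obtain ⟨x, hx, h1, h2, h3⟩ := hcon ε hε
    exact ⟨x, ⟨h1, h2, h3⟩, by rw [dist_comm]; exact hx⟩
  let 𝒰 := Ultrafilter.of (𝓝[S] (0 : EuclideanSpace ℝ (Fin m)))
  have hle : (𝒰 : Filter (EuclideanSpace ℝ (Fin m))) ≤ 𝓝[S] 0 := Ultrafilter.of_le _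
  have hS : ∀ᶠ x in (𝒰 : Filter (EuclideanSpace ℝ (Fin m))), x ∈ S := hle self_mem_nhdsWithin
  have ht : Tendsto (fun x : EuclideanSpace ℝ (Fin m) => x) 𝒰 (𝓝 0) :=
    hle.trans nhdsWithin_le_nhds
  have hP : PFor 𝒰 (fun x : EuclideanSpace ℝ (Fin m) => x) := by
    let e : EuclideanSpace ℝ (Fin m) ≃L[ℝ] (Fin m → ℝ) := EuclideanSpace.equiv (Fin m) ℝ
    apply PFor_transport 𝒰 e
    apply PFor_all
    have := e.continuous.tendsto 0
    rw [map_zero] at this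
    exact this.comp ht
  have hg : AnalyticAt ℝ (fun x : EuclideanSpace ℝ (Fin m) => inner ℝ x x) 0 :=
    ((innerSL ℝ : EuclideanSpace ℝ (Fin m) →L[ℝ] _).analyticAt_bilinear (0, 0)).comp
      (f := fun x : EuclideanSpace ℝ (Fin m) => (x, x)) (x := 0)
      (analyticAt_id.prod analyticAt_id)
  let g : An (EuclideanSpace ℝ (Fin m)) := ⟨_, hg⟩
  obtain ⟨c, hc⟩ := hP g 1 (by rw [map_one]; exact one_ne_zero) (by
    rintro w ⟨hw1, hw2⟩
    have h1 : ∀ j : Fin n, Dv 𝒰 (fun x => x) w (fun x => F x j) = 0 := by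
      intro j
      have hj : AnalyticAt ℝ (fun x => F x j) 0 :=
        AnalyticAt.comp (f := F) (x := 0)
          ((EuclideanSpace.proj j : EuclideanSpace ℝ (Fin n) →L[ℝ] ℝ).analyticAt _) hF
      refine hw2 ⟨_, hj⟩ ?_
      rw [ev_eq_zero_iff]
      filter_upwards [hS] with x hx
      change F x j = 0
      rw [hx.1]; rfl
    have h2 : ∀ᶠ x in (𝒰 : Filter (EuclideanSpace ℝ (Fin m))), ∀ j : Fin n, fderiv ℝ (fun x => F x j) x (w x) = 0 := by
      rw [Filter.eventually_all]
      intro j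
      exact (Dv_eq_iff 𝒰 _ _ _ (fun _ => 0)).1 (h1 j)
    have hd : ∀ᶠ x in (𝒰 : Filter (EuclideanSpace ℝ (Fin m))), DifferentiableAt ℝ F x :=
      ht.eventually (hF.eventually_analyticAt.mono fun _ h => h.differentiableAt)
    have h3 : Dv 𝒰 (fun x => x) w g.1 = 0 := by
      refine (Dv_eq_iff 𝒰 _ _ _ (fun _ => 0)).2 ?_
      filter_upwards [hS, h2, hd] with x hx h2 hd
      have h4 : fderiv ℝ F x (w x) = 0 := by
        ext j
        have h7 := h2 j
        have : HasFDerivAt (fun x => F x j) _ x :=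
          (EuclideanSpace.proj j : EuclideanSpace ℝ (Fin n) →L[ℝ] ℝ).hasFDerivAt.comp x
            hd.hasFDerivAt
        rw [this.fderiv] at h7
        exact h7
      have h5 := hx.2.1 _ h4
      change fderiv ℝ (fun x : EuclideanSpace ℝ (Fin m) => inner ℝ x x) x (w x) = 0
      rw [fderiv_inner_apply ℝ (f := fun x => x) (g := fun x => x) differentiableAt_id
        differentiableAt_id]
      simp [h5, real_inner_comm]
    have h6 : Dv 𝒰 (fun x => x) w (1 : An (EuclideanSpace ℝ (Fin m))).1 = 0 := by
      refine (Dv_eq_iff 𝒰 _ _ _ (fun _ => 0)).2 (Eventually.of_forall fun x => ?_)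
      change fderiv ℝ (fun _ : EuclideanSpace ℝ (Fin m) => (1:ℝ)) x (w x) = 0
      simp
    rw [h3, h6, mul_zero, mul_zero])
  have hc' : ∀ᶠ x in (𝒰 : Filter (EuclideanSpace ℝ (Fin m))), (inner ℝ x x : ℝ) = c := by
    filter_upwards [Germ.coe_eq.1 hc] with x hx
    have hx : (inner ℝ x x : ℝ) = c * 1 := hx
    rw [hx, mul_one]
  have hc0 : c = 0 := by
    have h1 : Tendsto (fun x : EuclideanSpace ℝ (Fin m) => (inner ℝ x x : ℝ)) (𝒰 : Filter (EuclideanSpace ℝ (Fin m))) (𝓝 0) := by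
      have := hg.continuousAt.tendsto.comp ht
      rw [inner_zero_left] at this; exact this
    have h2 : Tendsto (fun x : EuclideanSpace ℝ (Fin m) => (inner ℝ x x : ℝ)) (𝒰 : Filter (EuclideanSpace ℝ (Fin m))) (𝓝 c) :=
      tendsto_const_nhds.congr' (hc'.mono fun i hi => hi.symm)
    exact tendsto_nhds_unique h2 h1
  obtain ⟨x, hx, hxS⟩ := (hc'.and hS).exists
  rw [hc0, inner_self_eq_zero] at hx
  exact hxS.2.2 hx
end induction_dim

section final
open Filter

lemma eventually_surj {X E F : Type*} [TopologicalSpace X] [NormedAddCommGroup E] [NormedSpace ℝ E]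
    [NormedAddCommGroup F] [NormedSpace ℝ F] [FiniteDimensional ℝ F]
    (Λ : X → (E →L[ℝ] F)) (x : X) (hc : ContinuousAt Λ x) (hs : Surjective (Λ x)) :
    ∀ᶠ y in 𝓝 x, Surjective (Λ y) := by
  obtain ⟨R0, hR0⟩ := LinearMap.exists_rightInverse_of_surjective (Λ x : E →ₗ[ℝ] F)
    (LinearMap.range_eq_top.2 hs)
  let R : F →L[ℝ] E := LinearMap.toContinuousLinearMap R0
  have hR : (Λ x).comp R = 1 := by
    ext v
    exact congrArg (fun L : F →ₗ[ℝ] F => L v) hR0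
  have hc2 : ContinuousAt (fun y => (Λ y).comp R) x := hc.clm_comp continuousAt_const
  haveI : CompleteSpace F := FiniteDimensional.complete ℝ F
  have hmem : (fun y => (Λ y).comp R) x ∈ {T : F →L[ℝ] F | IsUnit T} := by
    change IsUnit ((Λ x).comp R)
    rw [hR]; exact isUnit_one
  filter_upwards [hc2.eventually_mem (Units.isOpen.mem_nhds hmem)] with y hy v
  obtain ⟨u, hu⟩ := hy
  refine ⟨R ((↑u⁻¹ : F →L[ℝ] F) v), ?_⟩
  have h1 : ((Λ y).comp R) * (↑u⁻¹ : F →L[ℝ] F) = 1 := by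
    have hu : (u : F →L[ℝ] F) = (Λ y).comp R := hu
    rw [← hu]; exact u.mul_inv
  exact congrArg (fun L : F →L[ℝ] F => L v) h1

lemma surj_prod {E F : Type*} [NormedAddCommGroup E] [NormedSpace ℝ E]
    [NormedAddCommGroup F] [NormedSpace ℝ F] (L : E →L[ℝ] F) (l : E →L[ℝ] ℝ) (hL : Surjective L) :
    ¬ Surjective (L.prod l) ↔ ∀ v, L v = 0 → l v = 0 := by
  constructor
  · intro h v hv
    by_contra hl
    apply h
    rintro ⟨y, s⟩
    obtain ⟨u, hu⟩ := hL y
    refine ⟨u + ((s - l u) / l v) • v, ?_⟩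
    simp [hu, hv, hl]
  · intro h hs
    obtain ⟨v, hv⟩ := hs (0, 1)
    have h1 : L v = 0 := congrArg Prod.fst hv
    have h2 : l v = 1 := congrArg Prod.snd hv
    rw [h v h1] at h2
    exact zero_ne_one h2

lemma fderiv_pair {E F : Type*} [NormedAddCommGroup E] [InnerProductSpace ℝ E]
    [NormedAddCommGroup F] [NormedSpace ℝ F] (P : E → F) (x : E) (hP : DifferentiableAt ℝ P x) :
    fderiv ℝ (fun y => (P y, ‖y‖ ^ 2)) x = (fderiv ℝ P x).prod (2 • innerSL ℝ x) :=
  (hP.hasFDerivAt.prodMk (hasStrictFDerivAt_norm_sq x).hasFDerivAt).fderiv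

lemma milnor_iff {E F : Type*} [NormedAddCommGroup E] [InnerProductSpace ℝ E]
    [NormedAddCommGroup F] [NormedSpace ℝ F] (P : E → F) (x : E) (hP : DifferentiableAt ℝ P x)
    (hx : x ∉ Sing P) :
    x ∈ MilnorSet P ↔ ∀ v, fderiv ℝ P x v = 0 → inner ℝ x v = 0 := by
  have hs : Surjective (fderiv ℝ P x) := by
    by_contra h; exact hx h
  change ¬ Surjective (fderiv ℝ (fun y => (P y, ‖y‖ ^ 2)) x) ↔ _
  rw [fderiv_pair P x hP, surj_prod _ _ hs]
  refine forall_congr' fun v => ?_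
  simp
end final


/-- Assume F is tame with Disc F ⊆ {0} and dG(0) is not surjective.
Then H = G ∘ F is tame iff, as set germs at the origin of ℝ^N,
closure(F(M(H) \ Sing H)) ∩ Sing G ⊆ {0}. -/
theorem stmt_11 {M N K : ℕ} (hMN : M ≥ N) (hNK : N ≥ K) (hK2 : K ≥ 2)
    (U : Set (EuclideanSpace ℝ (Fin M))) (V : Set (EuclideanSpace ℝ (Fin N)))
    (hUopen : IsOpen U) (hU0 : (0 : EuclideanSpace ℝ (Fin M)) ∈ U)
    (hVopen : IsOpen V) (hV0 : (0 : EuclideanSpace ℝ (Fin N)) ∈ V)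
    (F : EuclideanSpace ℝ (Fin M) → EuclideanSpace ℝ (Fin N))
    (G : EuclideanSpace ℝ (Fin N) → EuclideanSpace ℝ (Fin K))
    (hF : AnalyticOnNhd ℝ F U) (hG : AnalyticOnNhd ℝ G V)
    (hF0 : F 0 = 0) (hG0 : G 0 = 0) (hFUV : F '' U ⊆ V)
    (hFtame : Tame F) (hDiscF : F '' (Sing F ∩ U) ⊆ {0})
    (h0SingG : (0 : EuclideanSpace ℝ (Fin N)) ∈ Sing G)
    (H : EuclideanSpace ℝ (Fin M) → EuclideanSpace ℝ (Fin K)) (hH : H = G ∘ F) :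
    Tame H ↔
      ∃ ε > 0, ∃ δ > 0, closedBall (0 : EuclideanSpace ℝ (Fin M)) ε ⊆ U ∧
        closure (F '' ((MilnorSet H \ Sing H) ∩ closedBall 0 ε)) ∩ Sing G ∩
          ball (0 : EuclideanSpace ℝ (Fin N)) δ ⊆ {0} := by
  subst hH
  have hUd : ∀ x ∈ U, DifferentiableAt ℝ F x := fun x hx => (hF x hx).differentiableAt
  have hVd : ∀ x ∈ U, DifferentiableAt ℝ G (F x) := fun x hx =>
    (hG _ (hFUV ⟨x, hx, rfl⟩)).differentiableAt
  have hHd : ∀ x ∈ U, DifferentiableAt ℝ (G ∘ F) x := fun x hx => (hVd x hx).comp x (hUd x hx)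
  have hchain : ∀ x ∈ U, fderiv ℝ (G ∘ F) x = (fderiv ℝ G (F x)).comp (fderiv ℝ F x) :=
    fun x hx => fderiv_comp x (hVd x hx) (hUd x hx)
  have hSF0 : ∀ x ∈ U, x ∈ Sing F → F x = 0 := fun x hx h => hDiscF ⟨x, ⟨h, hx⟩, rfl⟩
  have hsing : ∀ x ∈ U, (x ∈ Sing (G ∘ F) ↔ F x ∈ Sing G) := by
    intro x hx
    constructor
    · intro h
      by_contra hcon
      have hG' : Surjective (fderiv ℝ G (F x)) := by
        by_contra h'; exact hcon h'
      have hF' : Surjective (fderiv ℝ F x) := by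
        by_contra h'
        apply hcon
        rw [hSF0 x hx h']
        exact h0SingG
      apply h
      rw [hchain x hx]
      exact hG'.comp hF'
    · intro h h'
      apply h
      rw [hchain x hx] at h'
      exact Function.Surjective.of_comp (g := fderiv ℝ F x) h'
  obtain ⟨r, hr, hrU⟩ := Metric.isOpen_iff.1 hUopen 0 hU0
  constructor
  · rintro ⟨ε0, hε0, hT⟩
    have hm : 0 < min ε0 r := lt_min hε0 hr
    have hsub1 : closedBall (0 : EuclideanSpace ℝ (Fin M)) (min ε0 r / 2) ⊆ ball 0 ε0 :=
      closedBall_subset_ball (by have := min_le_left ε0 r; linarith)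
    have hsub2 : closedBall (0 : EuclideanSpace ℝ (Fin M)) (min ε0 r / 2) ⊆ U :=
      (closedBall_subset_ball (by have := min_le_right ε0 r; linarith)).trans hrU
    refine ⟨min ε0 r / 2, by linarith, 1, one_pos, hsub2, ?_⟩
    rintro y ⟨⟨hy, hyS⟩, -⟩
    set A := (MilnorSet (G ∘ F) \ Sing (G ∘ F)) ∩ closedBall 0 (min ε0 r / 2) with hA
    have hcl : closure A ⊆ closedBall 0 (min ε0 r / 2) :=
      closure_minimal inter_subset_right isClosed_closedBall
    have hcomp : IsCompact (closure A) :=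
      (isCompact_closedBall _ _).of_isClosed_subset isClosed_closure hcl
    have hcont : ContinuousOn F (closure A) := fun x hx =>
      (hUd x (hsub2 (hcl hx))).continuousAt.continuousWithinAt
    have hy2 : y ∈ F '' closure A :=
      closure_minimal (image_mono subset_closure) (hcomp.image_of_continuousOn hcont).isClosed hy
    obtain ⟨x, hx, rfl⟩ := hy2
    have hx0 : x = 0 := by
      apply hT
      refine ⟨⟨closure_mono (inter_subset_inter_right _ hsub1) hx, ?_⟩, hsub1 (hcl hx)⟩
      exact (hsing x (hsub2 (hcl hx))).2 hyS
    rw [hx0, hF0]; rfl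
  · rintro ⟨ε, hε, δ, hδ, hsub, hcond⟩
    obtain ⟨ε1, hε1, hT⟩ := hFtame
    obtain ⟨ε2, hε2, hkey⟩ := key_lemma F (hF 0 hU0)
    have hc0 : ∀ᶠ x in 𝓝 (0 : EuclideanSpace ℝ (Fin M)), F x ∈ ball 0 δ := by
      apply (hUd 0 hU0).continuousAt.eventually_mem
      rw [hF0]; exact ball_mem_nhds 0 hδ
    obtain ⟨ε3, hε3, hb3⟩ := Metric.eventually_nhds_iff_ball.1 hc0
    set ε' := min (min ε ε1) (min ε2 ε3) with hε'
    have hle0 : ε' ≤ ε := (min_le_left _ _).trans (min_le_left _ _)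
    have hle1 : ε' ≤ ε1 := (min_le_left _ _).trans (min_le_right _ _)
    have hle2 : ε' ≤ ε2 := (min_le_right _ _).trans (min_le_left _ _)
    have hle3 : ε' ≤ ε3 := (min_le_right _ _).trans (min_le_right _ _)
    refine ⟨ε', lt_min (lt_min hε hε1) (lt_min hε2 hε3), ?_⟩
    rintro x ⟨⟨hxc, hxS⟩, hxb⟩
    have hbU : ball (0 : EuclideanSpace ℝ (Fin M)) ε' ⊆ U :=
      (ball_subset_ball hle0).trans (ball_subset_closedBall.trans hsub)
    have hxU := hbU hxb
    have hFx : F x = 0 := by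
      apply hcond
      refine ⟨⟨?_, (hsing x hxU).1 hxS⟩, hb3 x (ball_subset_ball hle3 hxb)⟩
      have h1 := mem_closure_image (hUd x hxU).continuousAt hxc
      refine closure_mono (image_mono (inter_subset_inter_right _ ?_)) h1
      exact (ball_subset_ball hle0).trans ball_subset_closedBall
    have hMM : (MilnorSet (G ∘ F) \ Sing (G ∘ F)) ∩ ball 0 ε' ⊆
        (MilnorSet F \ Sing F) ∩ ball 0 ε' := by
      rintro y ⟨⟨hy1, hy2⟩, hyb⟩
      have hyU := hbU hyb
      have hyF : y ∉ Sing F := by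
        intro h
        apply hy2
        rw [hsing y hyU, hSF0 y hyU h]
        exact h0SingG
      refine ⟨⟨?_, hyF⟩, hyb⟩
      rw [milnor_iff _ _ (hUd y hyU) hyF]
      intro v hv
      refine (milnor_iff _ _ (hHd y hyU) hy2).1 hy1 v ?_
      rw [hchain y hyU, ContinuousLinearMap.comp_apply, hv, map_zero]
    have hxc2 := closure_mono hMM hxc
    by_cases hxF : x ∈ Sing F
    · apply hT
      exact ⟨⟨closure_mono (inter_subset_inter_right _ (ball_subset_ball hle1)) hxc2, hxF⟩,
        ball_subset_ball hle1 hxb⟩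
    · have hxM : x ∈ MilnorSet F := by
        intro hs
        have hpair : AnalyticAt ℝ (fun y => (F y, ‖y‖ ^ 2)) x := by
          refine (hF x hxU).prod ?_
          have h1 : AnalyticAt ℝ (fun y : EuclideanSpace ℝ (Fin M) => (inner ℝ y y : ℝ)) x :=
            ((innerSL ℝ : EuclideanSpace ℝ (Fin M) →L[ℝ] _).analyticAt_bilinear (x, x)).comp
              (f := fun x : EuclideanSpace ℝ (Fin M) => (x, x)) (x := x)
              (analyticAt_id.prod analyticAt_id)
          simpa only [real_inner_self_eq_norm_sq] using h1
        have hev := eventually_surj (fderiv ℝ (fun y => (F y, ‖y‖ ^ 2))) x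
          hpair.fderiv.continuousAt hs
        obtain ⟨y, hy, hyM⟩ := mem_closure_iff_nhds.1 hxc2 _ hev
        exact hyM.1.1 hy
      exact hkey x (ball_subset_ball hle2 hxb) hFx
        ((milnor_iff _ _ (hUd x hxU) hxF).1 hxM)
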